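/- arXiv:1702.07365 — 3 statements merged into one kernel-verified Lean document; each statement's English description precedes it below -/
import Mathlib

section
/- The set of prime numbers is not metric Poissonian. More precisely, there exists s > 0 such that for Lebesgue-almost every α ∈ [0,1], the pair correlation function F(𝒫, α, s, N) does not converge to 2s as N → ∞, where 𝒫 is the increasing sequence of all primes. -/
open MeasureTheory Filter Finset
open scoped Classical

/-- Distance from a real number to the nearest integer. -/
noncomputable def intDist (x : ℝ) : ℝ := |x - round x|

/-- The pair correlation function `F(𝒜, α, s, N)` for the sequence `a` (1-indexed):
`(1/N) · #{(i,j) : 1 ≤ i,j ≤ N, i ≠ j, ‖α(a_i − a_j)‖ ≤ s/N}`. -/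
noncomputable def pairCorr (a : ℕ → ℕ) (α s : ℝ) (N : ℕ) : ℝ :=
  (((Finset.Icc 1 N ×ˢ Finset.Icc 1 N).filter
    (fun p => p.1 ≠ p.2 ∧ intDist (α * ((a p.1 : ℝ) - (a p.2 : ℝ))) ≤ s / N)).card : ℝ) / N

/-- A (strictly increasing) sequence is metric Poissonian if for a.e. `α ∈ [0,1]` and
every `s > 0`, `F(𝒜, α, s, N) → 2s`. -/
def MetricPoissonian (a : ℕ → ℕ) : Prop :=
  ∀ᵐ α ∂(volume.restrict (Set.Icc (0:ℝ) 1)),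
    ∀ s : ℝ, 0 < s → Tendsto (fun N => pairCorr a α s N) atTop (nhds (2 * s))

/-- The additive energy of a finite set of naturals: the number of quadruples
`(b₁,b₂,b₃,b₄) ∈ B⁴` with `b₁ + b₂ = b₃ + b₄`. -/
def addEnergy (B : Finset ℕ) : ℕ :=
  ((B ×ˢ B ×ˢ B ×ˢ B).filter (fun q => q.1 + q.2.1 = q.2.2.1 + q.2.2.2)).card

/-- The first `N` elements of the set associated to the (1-indexed) sequence `a`. -/
def firstN (a : ℕ → ℕ) (N : ℕ) : Finset ℕ := (Finset.Icc 1 N).image a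

/-- The increasing sequence of all primes, 1-indexed: `primeSeq 1 = 2`, `primeSeq 2 = 3`, … -/
noncomputable def primeSeq (n : ℕ) : ℕ := Nat.nth Nat.Prime (n - 1)


/-- Chebyshev-type upper bound for the n-th prime. -/
lemma primeSeq_bound (q : ℕ) (hq : 0 < q) :
    Nat.nth Nat.Prime (5 * q - 1) ≤ 512 * q * (Nat.log 4 q + 1) := by
  set k := Nat.log 4 q with hk
  obtain ⟨x, hx⟩ : ∃ x, x = 512 * q * (k + 1) := ⟨_, rfl⟩
  rw [← hx]
  have hx512 : 512 ≤ x := by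
    rw [hx]; nlinarith [Nat.zero_le k, Nat.mul_le_mul hq (Nat.succ_le_succ (Nat.zero_le k))]
  have hqk : q < 4 ^ (k + 1) := Nat.lt_pow_succ_log_self (by norm_num) q
  have hxle : x ≤ 2 ^ (3 * (k + 4)) := by
    have h1 : k + 1 ≤ 2 ^ (k + 1) := Nat.lt_two_pow_self.le
    calc x ≤ 512 * 4 ^ (k + 1) * 2 ^ (k + 1) := by rw [hx]; gcongr
      _ = 2 ^ (3 * (k + 4)) := by
        have : (4 : ℕ) = 2 ^ 2 := by norm_num
        rw [this, ← pow_mul]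
        have : (512 : ℕ) = 2 ^ 9 := by norm_num
        rw [this, ← pow_add, ← pow_add]; congr 1; ring
  have hxR : (512 : ℝ) ≤ x := by exact_mod_cast hx512
  have hlogx : Real.log x ≤ 12 * (k + 1) * Real.log 2 := by
    have h2 : (x : ℝ) ≤ 2 ^ (3 * (k + 4)) := by exact_mod_cast hxle
    have h3 := Real.log_le_log (by linarith) h2
    rw [Real.log_pow] at h3
    have := Real.log_pos (show (1 : ℝ) < 2 by norm_num)
    push_cast at h3
    have hk0 : (0 : ℝ) ≤ k := by positivity
    nlinarith
  have hlogpos : 0 < Real.log x := Real.log_pos (by linarith)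
  have hl2 := Real.log_two_gt_d9
  have hl2' := Real.log_two_lt_d9
  have hlog1 : Real.log (x + 1) ≤ x * Real.log 2 / 2 := by
    have h1 : Real.log ((x + 1) / 32) ≤ (x + 1) / 32 - 1 :=
      Real.log_le_sub_one_of_pos (by positivity)
    rw [Real.log_div (by positivity) (by norm_num)] at h1
    have h32 : Real.log 32 = 5 * Real.log 2 := by
      rw [show (32 : ℝ) = 2 ^ 5 by norm_num, Real.log_pow]; norm_num
    nlinarith
  have hpi := Chebyshev.pi_ge x
  have h5 : (5 * q : ℝ) ≤ Nat.primeCounting x := by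
    refine le_trans ?_ hpi
    rw [le_div_iff₀ hlogpos]
    have hq0 : (0 : ℝ) < q := by exact_mod_cast hq
    calc (5 * q : ℝ) * Real.log x ≤ 5 * q * (12 * (k + 1) * Real.log 2) :=
          mul_le_mul_of_nonneg_left hlogx (by positivity)
      _ ≤ x * Real.log 2 / 2 := by
        have : (x : ℝ) = 512 * q * (k + 1) := by rw [hx]; push_cast; ring
        rw [this]
        have ht : (0 : ℝ) ≤ q * (k + 1) * Real.log 2 := by positivity
        calc (5 * q * (12 * (k + 1) * Real.log 2) : ℝ) = 60 * (q * (k + 1) * Real.log 2) := by ring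
          _ ≤ 256 * (q * (k + 1) * Real.log 2) := by linarith
          _ = _ := by ring
      _ ≤ _ := by linarith
  have h5' : 5 * q ≤ Nat.primeCounting x := by exact_mod_cast h5
  have : 5 * q - 1 < Nat.count Nat.Prime (x + 1) := by
    have : Nat.primeCounting x = Nat.count Nat.Prime (x + 1) := rfl
    omega
  exact Nat.lt_succ_iff.mp (Nat.nth_lt_of_lt_count this)

/-- Pairs in the same residue class. -/
lemma pairs_mod (a : ℕ → ℕ) (q : ℕ) (hq : 0 < q) :
    20 * q ≤ (((Finset.Icc 1 (5 * q) ×ˢ Finset.Icc 1 (5 * q)).filter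
      (fun p => p.1 ≠ p.2 ∧ a p.1 % q = a p.2 % q)).card) := by
  set I := Finset.Icc 1 (5 * q) with hI
  have hIc : I.card = 5 * q := by simp [hI]
  have h1 : ((I ×ˢ I).filter (fun p => a p.1 % q = a p.2 % q)).card
      = ∑ c ∈ Finset.range q, ((I.filter (fun i => a i % q = c)).card) ^ 2 := by
    rw [Finset.card_eq_sum_card_fiberwise (f := fun p : ℕ × ℕ => a p.1 % q)
      (t := Finset.range q)]
    · refine Finset.sum_congr rfl fun c _ => ?_
      rw [sq, ← Finset.card_product]
      congr 1
      ext ⟨i, j⟩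
      simp only [Finset.mem_filter, Finset.mem_product]
      constructor
      · rintro ⟨⟨⟨h1, h2⟩, h3⟩, h4⟩; exact ⟨⟨h1, h4⟩, h2, h3 ▸ h4⟩
      · rintro ⟨⟨h1, h4⟩, h2, h3⟩; exact ⟨⟨⟨h1, h2⟩, h4.trans h3.symm⟩, h4⟩
    · intro p _
      simpa using Nat.mod_lt _ hq
  have h2 : ∑ c ∈ Finset.range q, ((I.filter (fun i => a i % q = c)).card) = 5 * q := by
    rw [← hIc]
    exact (Finset.card_eq_sum_card_fiberwise (fun i _ => by simpa using Nat.mod_lt _ hq)).symm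
  have h3 : 50 * q ≤ (∑ c ∈ Finset.range q, ((I.filter (fun i => a i % q = c)).card) ^ 2)
      + 25 * q := by
    calc 50 * q = ∑ c ∈ Finset.range q, 10 * ((I.filter (fun i => a i % q = c)).card) := by
          rw [← Finset.mul_sum, h2]; ring
      _ ≤ ∑ c ∈ Finset.range q, (((I.filter (fun i => a i % q = c)).card) ^ 2 + 25) := by
          refine Finset.sum_le_sum fun c _ => ?_
          generalize (I.filter (fun i => a i % q = c)).card = t
          zify
          nlinarith [sq_nonneg ((t : ℤ) - 5)]
      _ = _ := by simp [Finset.sum_add_distrib]; ring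
  have h4 : ((I ×ˢ I).filter (fun p => a p.1 % q = a p.2 % q)).card ≤
      ((I ×ˢ I).filter (fun p => p.1 ≠ p.2 ∧ a p.1 % q = a p.2 % q)).card + I.card := by
    rw [← Finset.diag_card I]
    refine le_trans (Finset.card_le_card ?_)
      (Finset.card_union_le ((I ×ˢ I).filter (fun p => p.1 ≠ p.2 ∧ a p.1 % q = a p.2 % q)) I.diag)
    rintro ⟨i, j⟩ h
    simp only [Finset.mem_filter, Finset.mem_product, Finset.mem_union, Finset.mem_diag] at h ⊢
    by_cases hij : i = j
    · right; exact ⟨h.1.1, hij⟩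
    · left; exact ⟨h.1, hij, h.2⟩
  omega

/-- If `q` approximates `α` very well, then the pair correlation at `N = 5q` is at least `4`. -/
lemma pairCorr_ge (α : ℝ) (q : ℕ) (hq : 0 < q)
    (h : ‖q • (α : UnitAddCircle)‖ ≤ 1 / (2560 * q * (Nat.log 4 q + 1))) :
    4 ≤ pairCorr primeSeq α 1 (5 * q) := by
  have hq0 : (0 : ℝ) < q := by exact_mod_cast hq
  have hb : ∀ i ∈ Finset.Icc 1 (5 * q), primeSeq i ≤ 512 * q * (Nat.log 4 q + 1) := by
    intro i hi
    rw [Finset.mem_Icc] at hi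
    refine le_trans ?_ (primeSeq_bound q hq)
    exact Nat.nth_monotone Nat.infinite_setOfPred_prime (by omega)
  have key : ∀ i j, i ∈ Finset.Icc 1 (5 * q) → j ∈ Finset.Icc 1 (5 * q) →
      primeSeq i % q = primeSeq j % q →
      intDist (α * ((primeSeq i : ℝ) - (primeSeq j : ℝ))) ≤ 1 / ((5 * q : ℕ) : ℝ) := by
    intro i j hi hj hij
    have hi' := hb i hi
    have hj' := hb j hj
    set x := primeSeq i
    set y := primeSeq j
    have hd : (q : ℤ) ∣ (x : ℤ) - y := (Nat.modEq_iff_dvd.mp (Eq.symm hij : y ≡ x [MOD q]))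
    obtain ⟨m, hm⟩ := hd
    have hmR : (x : ℝ) - y = q * m := by exact_mod_cast hm
    have hmb : |(m : ℝ)| ≤ 512 * (Nat.log 4 q + 1) := by
      have h1 : |(x : ℝ) - y| ≤ 512 * q * (Nat.log 4 q + 1) := by
        have hx : (x : ℝ) ≤ 512 * q * (Nat.log 4 q + 1) := by exact_mod_cast hi'
        have hy : (y : ℝ) ≤ 512 * q * (Nat.log 4 q + 1) := by exact_mod_cast hj'
        have hx0 : (0 : ℝ) ≤ x := by positivity
        have hy0 : (0 : ℝ) ≤ y := by positivity
        rw [abs_le]; constructor <;> linarith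
      rw [hmR, abs_mul, abs_of_pos hq0] at h1
      by_contra hcon
      push Not at hcon
      have := mul_lt_mul_of_pos_left hcon hq0
      linarith
    have e1 : intDist (α * ((x : ℝ) - y)) = ‖m • (q • (α : UnitAddCircle))‖ := by
      rw [intDist, ← UnitAddCircle.norm_eq, hmR, ← AddCircle.coe_nsmul, ← AddCircle.coe_zsmul]
      congr 2
      simp only [nsmul_eq_mul, zsmul_eq_mul]; ring
    rw [e1]
    calc ‖m • (q • (α : UnitAddCircle))‖ ≤ |(m : ℝ)| * ‖q • (α : UnitAddCircle)‖ := by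
          simpa [Int.norm_eq_abs] using norm_zsmul_le (a := q • (α : UnitAddCircle)) m
      _ ≤ (512 * (Nat.log 4 q + 1)) * (1 / (2560 * q * (Nat.log 4 q + 1))) := by gcongr
      _ = 1 / ((5 * q : ℕ) : ℝ) := by push_cast; field_simp; norm_num
  rw [pairCorr, le_div_iff₀ (by positivity)]
  have h1 := pairs_mod primeSeq q hq
  have h2 : ((Finset.Icc 1 (5 * q) ×ˢ Finset.Icc 1 (5 * q)).filter
      (fun p => p.1 ≠ p.2 ∧ primeSeq p.1 % q = primeSeq p.2 % q)).card ≤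
      ((Finset.Icc 1 (5 * q) ×ˢ Finset.Icc 1 (5 * q)).filter
    (fun p => p.1 ≠ p.2 ∧ intDist (α * ((primeSeq p.1 : ℝ) - (primeSeq p.2 : ℝ))) ≤
      1 / ((5 * q : ℕ) : ℝ))).card := by
    refine Finset.card_le_card fun p hp => ?_
    rw [Finset.mem_filter, Finset.mem_product] at hp ⊢
    exact ⟨hp.1, hp.2.1, key _ _ hp.1.1 hp.1.2 hp.2.2⟩
  have h3 := h1.trans h2
  have h4 : ((20 * q : ℕ) : ℝ) ≤ _ := Nat.cast_le.mpr h3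
  refine le_trans (le_of_eq ?_) h4
  push_cast; ring

lemma one_le_four_pow' (n : ℕ) : 1 ≤ 4 ^ n := Nat.one_le_pow _ _ (by norm_num)

/-- Block-wise lower bound for sums of the totient function. -/
lemma totient_block (k : ℕ) : 16 ^ k ≤ ∑ q ∈ Finset.Ico (4 ^ k) (4 ^ (k + 1)), Nat.totient q := by
  -- first: `∑_{d<Q} φ(d)/d ≥ Q/2`
  have h1 : ∀ m : ℕ, ((m : ℝ) + 1) / 2 * m ≤
      m * ∑ d ∈ Finset.Icc 1 m, (Nat.totient d : ℝ) / d := by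
    intro m
    have e1 : ∑ n ∈ Finset.Icc 1 m, n = ∑ d ∈ Finset.Icc 1 m, Nat.totient d * (m / d) := by
      calc ∑ n ∈ Finset.Icc 1 m, n
          = ∑ n ∈ Finset.Icc 1 m, ∑ d ∈ Finset.Icc 1 m, if d ∣ n then Nat.totient d else 0 := by
            refine Finset.sum_congr rfl fun n hn => ?_
            rw [Finset.mem_Icc] at hn
            rw [← Finset.sum_filter]
            conv_lhs => rw [← Nat.sum_totient n]
            refine Finset.sum_congr ?_ fun _ _ => rfl
            ext d
            simp only [Nat.mem_divisors, Finset.mem_filter, Finset.mem_Icc]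
            constructor
            · rintro ⟨h, h'⟩
              exact ⟨⟨Nat.pos_of_dvd_of_pos h (by omega), (Nat.le_of_dvd (by omega) h).trans hn.2⟩, h⟩
            · rintro ⟨_, h⟩
              exact ⟨h, by omega⟩
        _ = _ := by
            rw [Finset.sum_comm]
            refine Finset.sum_congr rfl fun d hd => ?_
            rw [← Finset.sum_filter, Finset.sum_const, smul_eq_mul, mul_comm]
            congr 1
            rw [← Nat.Ioc_filter_dvd_card_eq_div]
            congr 1
    have e2 : ((∑ n ∈ Finset.Icc 1 m, n : ℕ) : ℝ) = ((m : ℝ) + 1) / 2 * m := by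
      have : (∑ n ∈ Finset.Icc 1 m, n) = ∑ i ∈ Finset.range (m + 1), i := by
        rw [Finset.range_eq_Ico, Finset.sum_eq_sum_Ico_succ_bot (by omega)]
        simp only [zero_add]
        rfl
      rw [this]
      have h := Finset.sum_range_id_mul_two (m + 1)
      have h' : ((∑ i ∈ Finset.range (m + 1), i : ℕ) : ℝ) * 2 = (m + 1) * m := by
        exact_mod_cast h
      linarith
    rw [← e2, e1, Finset.mul_sum]
    push_cast
    refine Finset.sum_le_sum fun d hd => ?_
    calc (Nat.totient d : ℝ) * ((m / d : ℕ) : ℝ) ≤ Nat.totient d * ((m : ℝ) / d) := by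
          gcongr; exact Nat.cast_div_le
      _ = _ := by ring
  have hm : (((4 ^ (k + 1) - 1 : ℕ)) : ℝ) = 4 ^ (k + 1) - 1 := by
    rw [Nat.cast_sub (one_le_four_pow' _)]; push_cast; ring
  have h2 : (4 : ℝ) ^ (k + 1) / 2 ≤ ∑ d ∈ Finset.Ico 1 (4 ^ (k + 1)), (Nat.totient d : ℝ) / d := by
    have h := h1 (4 ^ (k + 1) - 1)
    have hpos : (0 : ℝ) < ((4 ^ (k + 1) - 1 : ℕ) : ℝ) := by
      rw [Nat.cast_pos]
      have : 4 ^ 1 ≤ 4 ^ (k + 1) := Nat.pow_le_pow_right (by norm_num) (by omega)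
      omega
    have hI : Finset.Icc 1 (4 ^ (k + 1) - 1) = Finset.Ico 1 (4 ^ (k + 1)) := by
      ext d
      have : 1 ≤ 4 ^ (k + 1) := (one_le_four_pow' _)
      simp only [Finset.mem_Icc, Finset.mem_Ico]; omega
    rw [mul_comm, hI] at h
    have h' := le_of_mul_le_mul_left h hpos
    rw [hm] at h'
    linarith
  have h3 : ∑ d ∈ Finset.Ico 1 (4 ^ k), (Nat.totient d : ℝ) / d ≤ 4 ^ k := by
    calc ∑ d ∈ Finset.Ico 1 (4 ^ k), (Nat.totient d : ℝ) / d
        ≤ ∑ d ∈ Finset.Ico 1 (4 ^ k), (1 : ℝ) := by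
          refine Finset.sum_le_sum fun d hd => ?_
          exact div_le_one_of_le₀ (by exact_mod_cast Nat.totient_le d) (by positivity)
      _ ≤ 4 ^ k := by
          simp only [Finset.sum_const, Nat.card_Ico, nsmul_eq_mul, mul_one]
          have : 4 ^ k - 1 ≤ 4 ^ k := Nat.sub_le _ _
          exact_mod_cast this
  have h4 := Finset.sum_Ico_consecutive (fun d => (Nat.totient d : ℝ) / d)
    (one_le_four_pow' k) (Nat.pow_le_pow_right (show 0 < 4 by norm_num) (Nat.le_succ k))
  have h5 : (4 : ℝ) ^ k ≤ ∑ d ∈ Finset.Ico (4 ^ k) (4 ^ (k + 1)), (Nat.totient d : ℝ) / d := by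
    rw [Nat.succ_eq_add_one] at h4
    rw [pow_succ] at h2
    linarith
  have h6 : (4 : ℝ) ^ k * ∑ d ∈ Finset.Ico (4 ^ k) (4 ^ (k + 1)), (Nat.totient d : ℝ) / d ≤
      ∑ d ∈ Finset.Ico (4 ^ k) (4 ^ (k + 1)), (Nat.totient d : ℝ) := by
    rw [Finset.mul_sum]
    refine Finset.sum_le_sum fun d hd => ?_
    rw [Finset.mem_Ico] at hd
    have hd1 : (4 : ℝ) ^ k ≤ d := by exact_mod_cast hd.1
    have hd0 : (0 : ℝ) < d := lt_of_lt_of_le (by positivity) hd1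
    calc (4 : ℝ) ^ k * ((Nat.totient d : ℝ) / d) ≤ d * ((Nat.totient d : ℝ) / d) := by gcongr
      _ = _ := by field_simp
  have h7 : (16 : ℝ) ^ k ≤ ∑ d ∈ Finset.Ico (4 ^ k) (4 ^ (k + 1)), (Nat.totient d : ℝ) := by
    refine le_trans ?_ h6
    calc (16 : ℝ) ^ k = 4 ^ k * 4 ^ k := by rw [← mul_pow]; norm_num
      _ ≤ _ := by gcongr
  exact_mod_cast h7

/-- A quantitative form of the divergence Borel–Cantelli lemma. -/
lemma union_lower_bound {Ω : Type*} [MeasurableSpace Ω] (μ : Measure Ω) [IsProbabilityMeasure μ]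
    (B : ℕ → Set Ω) (hB : ∀ k, MeasurableSet (B k)) (C : ℝ) (hC : 0 < C)
    (hov : ∀ k l, k < l → μ.real (B k ∩ B l) ≤ C * (μ.real (B k) * μ.real (B l)))
    (hsmall : ∀ k, μ.real (B k) ≤ 1 / (4 * C))
    (hdiv : Tendsto (fun n => ∑ k ∈ Finset.range n, μ.real (B k)) atTop atTop) (M : ℕ) :
    1 / (8 * C) ≤ μ.real (⋃ k ∈ Set.Ici M, B k) := by
  have hind : ∀ n, M ≤ n → ∑ k ∈ Finset.Ico M n, μ.real (B k) ≤ 1 / (2 * C) →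
      (∑ k ∈ Finset.Ico M n, μ.real (B k)) / 2 ≤ μ.real (⋃ k ∈ Finset.Ico M n, B k) := by
    intro n hn
    induction n, hn using Nat.le_induction with
    | base => simp
    | succ n hn ih =>
      intro hS
      rw [Finset.sum_Ico_succ_top hn] at hS ⊢
      have hb : 0 ≤ μ.real (B n) := measureReal_nonneg
      have ih' := ih (by linarith)
      set U := ⋃ k ∈ Finset.Ico M n, B k with hU
      have hUn : (⋃ k ∈ Finset.Ico M (n + 1), B k) = U ∪ B n := by
        rw [← Finset.insert_Ico_right_eq_Ico_add_one hn, Finset.set_biUnion_insert, Set.union_comm]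
      rw [hUn]
      have h1 := measureReal_union_add_inter (μ := μ) (s := U) (hB n) (measure_ne_top _ _) (measure_ne_top _ _)
      have h2 : μ.real (U ∩ B n) ≤ C * ((∑ k ∈ Finset.Ico M n, μ.real (B k)) * μ.real (B n)) := by
        have : U ∩ B n = ⋃ k ∈ Finset.Ico M n, (B k ∩ B n) := by
          rw [hU, Set.iUnion₂_inter]
        rw [this]
        refine (measureReal_biUnion_finset_le _ _).trans ?_
        rw [Finset.sum_mul, Finset.mul_sum]
        exact Finset.sum_le_sum fun k hk => hov k n (Finset.mem_Ico.mp hk).2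
      set S := ∑ k ∈ Finset.Ico M n, μ.real (B k)
      have h3 : C * S ≤ 1 / 2 := by
        have : S ≤ 1 / (2 * C) := by linarith
        calc C * S ≤ C * (1 / (2 * C)) := by gcongr
          _ = 1 / 2 := by field_simp
      have h4 : C * (S * μ.real (B n)) ≤ 1 / 2 * μ.real (B n) := by
        rw [← mul_assoc]; gcongr
      linarith
  have hex : ∃ n, M ≤ n ∧ 1 / (2 * C) < ∑ k ∈ Finset.Ico M n, μ.real (B k) := by
    have := (hdiv.eventually_gt_atTop
      (1 / (2 * C) + ∑ k ∈ Finset.range M, μ.real (B k))).and (eventually_ge_atTop M)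
    obtain ⟨n, hn, hMn⟩ := this.exists
    refine ⟨n, hMn, ?_⟩
    have := Finset.sum_range_add_sum_Ico (fun k => μ.real (B k)) hMn
    linarith
  obtain ⟨hn1, hn2⟩ := Nat.find_spec hex
  set n := Nat.find hex with hn
  have hMn : M ≠ n := by
    intro h
    rw [← h] at hn2
    simp only [Finset.Ico_self, Finset.sum_empty] at hn2
    have : 0 < 1 / (2 * C) := by positivity
    linarith
  obtain ⟨m, hm⟩ : ∃ m, n = m + 1 := ⟨n - 1, by omega⟩
  have hmin := Nat.find_min hex (m := m) (by omega)
  have hMm : M ≤ m := by omega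
  have hS : ∑ k ∈ Finset.Ico M m, μ.real (B k) ≤ 1 / (2 * C) := by
    by_contra h
    exact hmin ⟨hMm, not_le.mp h⟩
  have h1 := hind m hMm hS
  rw [hm, Finset.sum_Ico_succ_top hMm] at hn2
  have h2 := hsmall m
  have h3 : μ.real (⋃ k ∈ Finset.Ico M m, B k) ≤ μ.real (⋃ k ∈ Set.Ici M, B k) := by
    refine measureReal_mono ?_ (measure_ne_top _ _)
    refine Set.biUnion_subset_biUnion_left fun k hk => ?_
    exact (Finset.mem_Ico.mp hk).1
  have e1 : 1 / (2 * C) = 4 * (1 / (8 * C)) := by field_simp; norm_num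
  have e2 : 1 / (4 * C) = 2 * (1 / (8 * C)) := by field_simp; norm_num
  linarith

/-- The torsion points of the circle whose order lies in `[4^k, 4^(k+1))`. -/
noncomputable def torsBlock (k : ℕ) : Finset UnitAddCircle :=
  (Finset.Ico (4 ^ k) (4 ^ (k + 1))).biUnion fun q =>
    if h : 0 < q then
      (AddCircle.finite_setOfPred_addOrderOf_eq (1 : ℝ) h).toFinset else ∅

lemma mem_torsBlock {k : ℕ} {y : UnitAddCircle} :
    y ∈ torsBlock k ↔ 4 ^ k ≤ addOrderOf y ∧ addOrderOf y < 4 ^ (k + 1) := by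
  have hk := one_le_four_pow' k
  rw [torsBlock, Finset.mem_biUnion]
  constructor
  · rintro ⟨q, hq, hy⟩
    rw [Finset.mem_Ico] at hq
    rw [dif_pos (by omega), Set.Finite.mem_toFinset] at hy
    have hy' : addOrderOf y = q := hy
    rw [hy']; exact hq
  · intro h
    refine ⟨addOrderOf y, Finset.mem_Ico.mpr h, ?_⟩
    rw [dif_pos (by omega), Set.Finite.mem_toFinset]
    rfl

lemma card_torsBlock (k : ℕ) :
    (torsBlock k).card = ∑ q ∈ Finset.Ico (4 ^ k) (4 ^ (k + 1)), Nat.totient q := by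
  have hk := one_le_four_pow' k
  rw [torsBlock, Finset.card_biUnion]
  · refine Finset.sum_congr rfl fun q hq => ?_
    rw [Finset.mem_Ico] at hq
    rw [dif_pos (by omega), ← AddCircle.card_addOrderOf_eq_totient (p := (1 : ℝ))]
    exact (Set.ncard_eq_toFinset_card _ _).symm
  · intro q hq r hr hqr
    rw [Finset.mem_coe, Finset.mem_Ico] at hq hr
    simp only [Function.onFun]
    rw [dif_pos (by omega), dif_pos (by omega), Finset.disjoint_left]
    intro y h1 h2
    rw [Set.Finite.mem_toFinset] at h1 h2
    have h1' : addOrderOf y = q := h1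
    have h2' : addOrderOf y = r := h2
    exact hqr (h1'.symm.trans h2')

lemma card_torsBlock_ge (k : ℕ) : (16 : ℝ) ^ k ≤ (torsBlock k).card := by
  rw [card_torsBlock]
  exact_mod_cast totient_block k

lemma card_torsBlock_le (k : ℕ) : ((torsBlock k).card : ℝ) ≤ 16 ^ (k + 1) := by
  rw [card_torsBlock]
  have : ∑ q ∈ Finset.Ico (4 ^ k) (4 ^ (k + 1)), Nat.totient q ≤ 16 ^ (k + 1) := by
    calc ∑ q ∈ Finset.Ico (4 ^ k) (4 ^ (k + 1)), Nat.totient q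
        ≤ ∑ q ∈ Finset.Ico (4 ^ k) (4 ^ (k + 1)), 4 ^ (k + 1) := by
          refine Finset.sum_le_sum fun q hq => ?_
          exact (Nat.totient_le q).trans (Finset.mem_Ico.mp hq).2.le
      _ ≤ 4 ^ (k + 1) * 4 ^ (k + 1) := by
          rw [Finset.sum_const, Nat.card_Ico, smul_eq_mul]
          exact Nat.mul_le_mul_right _ (Nat.sub_le _ _)
      _ = 16 ^ (k + 1) := by rw [← mul_pow]; norm_num
  exact_mod_cast this

/-- Distinct torsion points are well separated. -/
lemma torsion_sep {y z : UnitAddCircle} {m n : ℕ} (hy : addOrderOf y ≤ m) (hz : addOrderOf z ≤ n)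
    (hy0 : 0 < addOrderOf y) (hz0 : 0 < addOrderOf z) (hyz : y ≠ z) :
    1 / ((m : ℝ) * n) ≤ dist y z := by
  have hm : 0 < m := by omega
  have hn : 0 < n := by omega
  have hu : (addOrderOf y * addOrderOf z) • (y - z) = 0 := by
    rw [smul_sub, mul_comm, mul_smul, addOrderOf_nsmul_eq_zero, smul_zero, mul_comm, mul_smul,
      addOrderOf_nsmul_eq_zero, smul_zero, sub_zero]
  have hpos : 0 < addOrderOf y * addOrderOf z := Nat.mul_pos hy0 hz0
  have hfin : IsOfFinAddOrder (y - z) := isOfFinAddOrder_iff_nsmul_eq_zero.mpr ⟨_, hpos, hu⟩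
  have h1 := AddCircle.le_add_order_smul_norm_of_isOfFinAddOrder hfin (sub_ne_zero.mpr hyz)
  have h2 : addOrderOf (y - z) ≤ m * n :=
    (Nat.le_of_dvd hpos (addOrderOf_dvd_of_nsmul_eq_zero hu)).trans (Nat.mul_le_mul hy hz)
  rw [nsmul_eq_mul] at h1
  rw [dist_eq_norm, div_le_iff₀ (by positivity)]
  refine h1.trans ?_
  rw [mul_comm]
  gcongr
  exact_mod_cast h2

lemma torsBlock_sep {k l : ℕ} {y z : UnitAddCircle} (hy : y ∈ torsBlock k) (hz : z ∈ torsBlock l)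
    (hyz : y ≠ z) : 1 / ((4 : ℝ) ^ (k + 1) * 4 ^ (l + 1)) ≤ dist y z := by
  rw [mem_torsBlock] at hy hz
  have := one_le_four_pow' k
  have := one_le_four_pow' l
  have h := torsion_sep hy.2.le hz.2.le (by omega) (by omega) hyz
  push_cast at h
  exact h

lemma volume_real_ball (x : UnitAddCircle) (r : ℝ) (h0 : 0 ≤ r) (h1 : 2 * r ≤ 1) :
    (volume : Measure UnitAddCircle).real (Metric.ball x r) = 2 * r := by
  rw [← measureReal_congr (AddCircle.closedBall_ae_eq_ball), measureReal_def,
    AddCircle.volume_closedBall, min_eq_right h1, ENNReal.toReal_ofReal (by linarith)]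

lemma volume_real_ball_le (x : UnitAddCircle) (r : ℝ) (h0 : 0 ≤ r) :
    (volume : Measure UnitAddCircle).real (Metric.ball x r) ≤ 2 * r := by
  rw [← measureReal_congr (AddCircle.closedBall_ae_eq_ball), measureReal_def,
    AddCircle.volume_closedBall, ENNReal.toReal_ofReal (le_min (by norm_num) (by linarith))]
  exact min_le_right _ _

/-- The approximation radius in the `k`-th block. -/
noncomputable def rad (k : ℕ) : ℝ := 1 / (2560 * 16 ^ (k + 1) * (k + 1))

lemma rad_pos (k : ℕ) : 0 < rad k := by unfold rad; positivity

lemma rad_le (k : ℕ) : 2560 * rad k ≤ 1 / 16 ^ (k + 1) := by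
  have h : 2560 * rad k = 1 / 16 ^ (k + 1) * (1 / ((k : ℝ) + 1)) := by unfold rad; field_simp
  rw [h]
  have : 1 / ((k : ℝ) + 1) ≤ 1 := by
    rw [div_le_one (by positivity)]; have : (0 : ℝ) ≤ k := by positivity
    linarith
  exact mul_le_of_le_one_right (by positivity) this

lemma sixteen_inv_le (k : ℕ) : (1 : ℝ) / 16 ^ (k + 1) ≤ 1 / 16 := by
  have : (16 : ℝ) ^ 1 ≤ 16 ^ (k + 1) := pow_le_pow_right₀ (by norm_num) (by omega)
  exact one_div_le_one_div_of_le (by norm_num) (by simpa using this)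

lemma rad_anti {k l : ℕ} (h : k ≤ l) : rad l ≤ rad k := by
  unfold rad
  have : (16 : ℝ) ^ (k + 1) ≤ 16 ^ (l + 1) := pow_le_pow_right₀ (by norm_num) (by omega)
  gcongr

/-- The `k`-th approximation event. -/
noncomputable def appSet (k : ℕ) : Set UnitAddCircle := ⋃ y ∈ torsBlock k, Metric.ball y (rad k)

lemma sep_self {k : ℕ} {y z : UnitAddCircle} (hy : y ∈ torsBlock k) (hz : z ∈ torsBlock k)
    (hyz : y ≠ z) : 1 / (16 : ℝ) ^ (k + 1) ≤ dist y z := by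
  have := torsBlock_sep hy hz hyz
  rwa [← mul_pow, show (4 : ℝ) * 4 = 16 by norm_num] at this

lemma volume_real_balls {k : ℕ} (Z : Finset UnitAddCircle) (hZ : Z ⊆ torsBlock k) (r : ℝ)
    (h0 : 0 ≤ r) (hr : 2 * r ≤ 1 / 16 ^ (k + 1)) :
    (volume : Measure UnitAddCircle).real (⋃ y ∈ Z, Metric.ball y r) = Z.card * (2 * r) := by
  rw [measureReal_biUnion_finset]
  · have := sixteen_inv_le k
    rw [Finset.sum_congr rfl fun y _ => volume_real_ball y r h0 (by linarith)]
    simp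
  · intro y hy z hz hyz
    refine Metric.ball_disjoint_ball ?_
    have := sep_self (hZ hy) (hZ hz) hyz
    linarith
  · exact fun _ _ => measurableSet_ball

lemma volume_appSet (k : ℕ) :
    (volume : Measure UnitAddCircle).real (appSet k) = (torsBlock k).card * (2 * rad k) := by
  refine volume_real_balls _ subset_rfl _ (rad_pos k).le ?_
  linarith [rad_le k, rad_pos k]

lemma count_near {k l : ℕ} (hkl : k < l) {y : UnitAddCircle} (hy : y ∈ torsBlock k) :
    (((torsBlock l).filter (fun z => dist z y < 2 * rad k)).card : ℝ) ≤
      6 * rad k * 16 ^ (l + 1) := by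
  set Z := (torsBlock l).filter (fun z => dist z y < 2 * rad k) with hZ
  rcases Z.eq_empty_or_nonempty with h | ⟨z, hz⟩
  · rw [h]
    have := rad_pos k
    simp; positivity
  obtain ⟨σ, hσ⟩ : ∃ σ : ℝ, σ = 1 / 16 ^ (l + 1) := ⟨_, rfl⟩
  have hσ0 : 0 < σ := by rw [hσ]; positivity
  have hσr : σ ≤ 2 * rad k := by
    rw [hZ, Finset.mem_filter] at hz
    have hzy : z ≠ y := by
      rintro rfl
      have h1 := mem_torsBlock.mp hy
      have h2 := mem_torsBlock.mp hz.1
      have : 4 ^ (k + 1) ≤ 4 ^ l := Nat.pow_le_pow_right (by norm_num) hkl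
      omega
    have h := torsBlock_sep hz.1 hy hzy
    refine le_trans ?_ (h.trans hz.2.le)
    rw [hσ, show (16 : ℝ) = 4 * 4 by norm_num, mul_pow]
    have : (4 : ℝ) ^ (k + 1) ≤ 4 ^ (l + 1) := pow_le_pow_right₀ (by norm_num) (by omega)
    gcongr
  have h1 := volume_real_balls Z (Finset.filter_subset _ _) (σ / 2) (by positivity) (by rw [← hσ]; linarith)
  have h2 : (⋃ z ∈ Z, Metric.ball z (σ / 2)) ⊆ Metric.ball y (2 * rad k + σ / 2) := by
    refine Set.iUnion₂_subset fun z hz => ?_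
    rw [hZ, Finset.mem_filter] at hz
    refine Metric.ball_subset_ball' ?_
    linarith
  have h3 := measureReal_mono (μ := (volume : Measure UnitAddCircle)) h2 (measure_ne_top _ _)
  have h4 := volume_real_ball_le y (2 * rad k + σ / 2) (by linarith [rad_pos k])
  have h5 : Z.card * σ ≤ 6 * rad k := by
    rw [h1] at h3
    have : (Z.card : ℝ) * (2 * (σ / 2)) = Z.card * σ := by ring
    linarith
  rw [hσ, mul_one_div, div_le_iff₀ (by positivity)] at h5
  exact h5

lemma appSet_overlap (k l : ℕ) (hkl : k < l) :
    (volume : Measure UnitAddCircle).real (appSet k ∩ appSet l) ≤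
      48 * ((volume : Measure UnitAddCircle).real (appSet k) *
        (volume : Measure UnitAddCircle).real (appSet l)) := by
  have hsub : appSet k ∩ appSet l ⊆ ⋃ y ∈ torsBlock k,
      ⋃ z ∈ (torsBlock l).filter (fun z => dist z y < 2 * rad k), Metric.ball z (rad l) := by
    rintro x ⟨hx1, hx2⟩
    simp only [appSet, Set.mem_iUnion, exists_prop] at hx1 hx2 ⊢
    obtain ⟨y, hy, hxy⟩ := hx1
    obtain ⟨z, hz, hxz⟩ := hx2
    refine ⟨y, hy, z, ?_, hxz⟩
    rw [Finset.mem_filter]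
    refine ⟨hz, ?_⟩
    rw [Metric.mem_ball] at hxy hxz
    have := dist_triangle_left z y x
    have := rad_anti hkl.le
    linarith
  have hk0 := rad_pos k
  have hl0 := rad_pos l
  refine (measureReal_mono hsub (measure_ne_top _ _)).trans ?_
  refine (measureReal_biUnion_finset_le _ _).trans ?_
  calc _ ≤ ∑ y ∈ torsBlock k, 6 * rad k * 16 ^ (l + 1) * (2 * rad l) := by
        refine Finset.sum_le_sum fun y hy => ?_
        rw [volume_real_balls _ (Finset.filter_subset _ _) _ hl0.le (by linarith [rad_le l])]
        gcongr
        exact count_near hkl hy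
    _ = (torsBlock k).card * (6 * rad k * (16 ^ l * 16) * (2 * rad l)) := by
        rw [Finset.sum_const, nsmul_eq_mul, pow_succ]
    _ ≤ (torsBlock k).card * (6 * rad k * ((torsBlock l).card * 16) * (2 * rad l)) := by
        gcongr
        exact card_torsBlock_ge l
    _ = _ := by rw [volume_appSet, volume_appSet]; ring

lemma appSet_small (k : ℕ) :
    (volume : Measure UnitAddCircle).real (appSet k) ≤ 1 / (4 * 48) := by
  rw [volume_appSet]
  have h1 := card_torsBlock_le k
  have h0 := rad_pos k
  have h2 := rad_le k
  rw [le_div_iff₀ (by positivity)] at h2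
  have h3 : ((torsBlock k).card : ℝ) * (2 * rad k) ≤ 16 ^ (k + 1) * (2 * rad k) := by gcongr
  linarith

lemma appSet_div : Tendsto (fun n => ∑ k ∈ Finset.range n,
    (volume : Measure UnitAddCircle).real (appSet k)) atTop atTop := by
  have h := (Real.tendsto_sum_range_one_div_nat_succ_atTop).const_mul_atTop
    (show (0 : ℝ) < 1 / 20480 by norm_num)
  refine tendsto_atTop_mono (fun n => ?_) h
  rw [Finset.mul_sum]
  refine Finset.sum_le_sum fun k _ => ?_
  rw [volume_appSet]
  have h0 := rad_pos k
  calc 1 / 20480 * (1 / ((k : ℝ) + 1)) = 16 ^ k * (2 * rad k) := by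
        unfold rad; rw [pow_succ]; field_simp; norm_num
    _ ≤ _ := by gcongr; exact card_torsBlock_ge k

lemma mem_wellApprox (δ : ℕ → ℝ) (x : UnitAddCircle) :
    x ∈ addWellApproximable UnitAddCircle δ ↔
      ∃ᶠ n in atTop, 0 < n ∧ ∃ y : UnitAddCircle, addOrderOf y = n ∧ dist x y < δ n := by
  rw [Nat.frequently_atTop_iff_infinite, mem_add_wellApproximable_iff, ← Nat.cofinite_eq_atTop,
    cofinite.blimsup_set_eq]
  simp only [Set.mem_ofPred_eq, mem_approx_add_orderOf_iff, Metric.mem_ball]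

/-- Khinchin-type theorem: almost every point is well approximable. -/
lemma ae_wellApprox : ∀ᵐ x : UnitAddCircle,
    x ∈ addWellApproximable UnitAddCircle (fun q => rad (Nat.log 4 q)) := by
  have hlog : Tendsto (fun q => Nat.log 4 q) atTop atTop := by
    refine tendsto_atTop.mpr fun b => ?_
    filter_upwards [eventually_ge_atTop (4 ^ b)] with q hq
    have := one_le_four_pow' b
    exact (Nat.le_log_iff_pow_le (by norm_num) (by omega)).mpr hq
  have hrad : Tendsto rad atTop (nhds 0) := by
    refine squeeze_zero (fun k => (rad_pos k).le) (fun k => ?_)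
      tendsto_one_div_add_atTop_nhds_zero_nat
    unfold rad
    have : (1 : ℝ) ≤ 16 ^ (k + 1) := one_le_pow₀ (by norm_num)
    refine one_div_le_one_div_of_le (by positivity) ?_
    have hk : (0 : ℝ) ≤ (k : ℝ) + 1 := by positivity
    nlinarith
  rcases AddCircle.addWellApproximable_ae_empty_or_univ (T := 1) _ (hrad.comp hlog) with h | h
  swap
  · exact h
  exfalso
  have hanti : Antitone (fun M => ⋃ k ∈ Set.Ici M, appSet k) := by
    intro M N hMN
    exact Set.biUnion_subset_biUnion_left (Set.Ici_subset_Ici.mpr hMN)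
  have hmeas : ∀ k, MeasurableSet (appSet k) := fun k =>
    Finset.measurableSet_biUnion _ fun _ _ => measurableSet_ball
  have hlim := tendsto_measure_iInter_atTop (μ := (volume : Measure UnitAddCircle))
    (s := fun M => ⋃ k ∈ Set.Ici M, appSet k)
    (fun M => (MeasurableSet.biUnion (Set.to_countable _) fun k _ => hmeas k).nullMeasurableSet)
    hanti ⟨0, measure_ne_top _ _⟩
  have hnull : (volume : Measure UnitAddCircle) (⋂ M, ⋃ k ∈ Set.Ici M, appSet k) = 0 := by
    refine measure_mono_null ?_ (ae_iff.mp h)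
    intro x hx
    rw [Set.mem_ofPred_eq, not_not]
    refine (mem_wellApprox _ x).mpr (Filter.frequently_atTop.mpr fun n => ?_)
    have hx' := Set.mem_iInter.mp hx n
    simp only [Set.mem_iUnion, Set.mem_Ici, exists_prop, appSet] at hx'
    obtain ⟨k, hk, y, hy, hxy⟩ := hx'
    rw [mem_torsBlock] at hy
    have hk4 : k < 4 ^ k := Nat.lt_pow_self (by norm_num)
    have hl : Nat.log 4 (addOrderOf y) = k := Nat.log_eq_of_pow_le_of_lt_pow hy.1 hy.2
    refine ⟨addOrderOf y, by omega, by omega, y, rfl, ?_⟩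
    simp only [Function.comp, hl]
    exact hxy
  rw [hnull] at hlim
  have hlow : ∀ M, ENNReal.ofReal (1 / (8 * 48)) ≤
      (volume : Measure UnitAddCircle) (⋃ k ∈ Set.Ici M, appSet k) := by
    intro M
    have hprob : IsProbabilityMeasure (volume : Measure UnitAddCircle) :=
      ⟨UnitAddCircle.measure_univ⟩
    have := union_lower_bound (volume : Measure UnitAddCircle) appSet hmeas 48 (by norm_num)
      appSet_overlap appSet_small appSet_div M
    exact ENNReal.ofReal_le_of_le_toReal this
  have := ge_of_tendsto' hlim hlow
  norm_num at this

/-- **The primes are not metric Poissonian.** There exists `s > 0` such that for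
Lebesgue-almost every `α ∈ [0,1]`, the pair correlation function `F(𝒫, α, s, N)`
does not converge to `2s` as `N → ∞`. -/
theorem primes_not_metricPoissonian :
    ∃ s : ℝ, 0 < s ∧
      ∀ᵐ α ∂(volume.restrict (Set.Icc (0:ℝ) 1)),
        ¬ Tendsto (fun N => pairCorr primeSeq α s N) atTop (nhds (2 * s)) := by
  refine ⟨1, one_pos, ?_⟩
  have hmp := UnitAddCircle.measurePreserving_mk 0
  have hae := hmp.quasiMeasurePreserving.ae ae_wellApprox
  rw [zero_add, Measure.restrict_congr_set Ioc_ae_eq_Icc] at hae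
  filter_upwards [hae] with α hα hT
  rw [mem_wellApprox] at hα
  have hlt : ∀ᶠ N in atTop, pairCorr primeSeq α 1 N < 4 :=
    hT.eventually (gt_mem_nhds (by norm_num))
  obtain ⟨N₀, hN₀⟩ := eventually_atTop.mp hlt
  obtain ⟨q, hqN, hq, y, hy, hd⟩ := Filter.frequently_atTop.mp hα N₀
  have hge := pairCorr_ge α q hq ?_
  · exact absurd (hN₀ (5 * q) (by omega)) (not_lt.mpr hge)
  have hq0 : (0 : ℝ) < q := by exact_mod_cast hq
  have e1 : q • (α : UnitAddCircle) = q • ((α : UnitAddCircle) - y) := by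
    rw [smul_sub, ← hy, addOrderOf_nsmul_eq_zero, sub_zero]
  rw [e1]
  rw [dist_eq_norm] at hd
  have hqk : q ≤ 4 ^ (Nat.log 4 q + 1) := (Nat.lt_pow_succ_log_self (by norm_num) q).le
  have hqk' : (q : ℝ) ≤ 4 ^ (Nat.log 4 q + 1) := by exact_mod_cast hqk
  calc ‖q • ((α : UnitAddCircle) - y)‖ ≤ q * ‖(α : UnitAddCircle) - y‖ := norm_nsmul_le
    _ ≤ q * rad (Nat.log 4 q) := by gcongr
    _ ≤ q * (1 / (2560 * (q * q) * (Nat.log 4 q + 1))) := by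
        unfold rad
        have : (q : ℝ) * q ≤ 16 ^ (Nat.log 4 q + 1) := by
          rw [show (16 : ℝ) = 4 * 4 by norm_num, mul_pow]; gcongr
        gcongr
    _ = _ := by field_simp
end

section
/- (Bourgain) Let 𝒜 = {a_1 < a_2 < …} be an infinite set of natural numbers and suppose that limsup_{N→∞} E(A_N)/N³ > 0, where A_N is the set of the first N elements of 𝒜. Then 𝒜 is not metric Poissonian. -/
open MeasureTheory Filter Finset
open scoped Classical

noncomputable def indD (δ x : ℝ) : ℝ := if intDist x ≤ δ then 1 else 0

lemma measurable_intDist : Measurable intDist := by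
  have : intDist = fun x : ℝ => min (Int.fract x) (1 - Int.fract x) := by
    funext x; exact abs_sub_round_eq_min x
  rw [this]
  exact measurable_fract.min (measurable_const.sub measurable_fract)

lemma measurable_indD (δ : ℝ) : Measurable (indD δ) :=
  Measurable.ite (measurableSet_le measurable_intDist measurable_const)
    measurable_const measurable_const

lemma indD_nonneg (δ x : ℝ) : 0 ≤ indD δ x := by
  unfold indD; split_ifs <;> norm_num

lemma indD_le_one (δ x : ℝ) : indD δ x ≤ 1 := by
  unfold indD; split_ifs <;> norm_num

lemma indD_periodic (δ : ℝ) : Function.Periodic (indD δ) 1 := by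
  intro x
  have : intDist (x + 1) = intDist x := by
    unfold intDist
    rw [round_add_one]; push_cast; congr 1; ring
  unfold indD; rw [this]

lemma integrable_indD_comp (δ c u v : ℝ) :
    IntervalIntegrable (fun x => indD δ (x * c)) volume u v := by
  rw [intervalIntegrable_iff]
  refine Measure.integrableOn_of_bounded (M := 1) (by simp) ?_ ?_
  · exact ((measurable_indD δ).comp (measurable_id.mul_const c)).aestronglyMeasurable
  · refine Eventually.of_forall fun x => ?_
    rw [Real.norm_eq_abs, abs_of_nonneg (indD_nonneg _ _)]
    exact indD_le_one _ _

lemma integral_indD_one (δ : ℝ) (h0 : 0 ≤ δ) (h1 : δ < 1 / 2) :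
    ∫ x in (0:ℝ)..1, indD δ x = 2 * δ := by
  have hp := (indD_periodic δ).intervalIntegral_add_eq 0 (-(1/2))
  rw [zero_add] at hp
  rw [hp]
  norm_num only [neg_add_eq_sub]
  have : ∫ x in (-(1/2) : ℝ)..(1/2), indD δ x
      = ∫ x in (-(1/2) : ℝ)..(1/2), (Set.Icc (-δ) δ).indicator (fun _ => (1:ℝ)) x := by
    apply intervalIntegral.integral_congr_ae
    have hne : ∀ᵐ x : ℝ, x ≠ 1/2 := by simp [ae_iff]
    filter_upwards [hne] with x hx hm
    rw [Set.uIoc_of_le (by norm_num)] at hm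
    have hlt : x < 1/2 := lt_of_le_of_ne hm.2 hx
    have hr : round x = 0 := by
      rw [round_eq, Int.floor_eq_zero_iff]
      constructor <;> linarith [hm.1]
    unfold indD intDist
    rw [hr]
    simp only [Int.cast_zero, sub_zero, abs_le, Set.indicator, Set.mem_Icc]
  rw [this, intervalIntegral.integral_of_le (by norm_num), setIntegral_indicator measurableSet_Icc]
  have hs : Set.Ioc (-(1/2):ℝ) (1/2) ∩ Set.Icc (-δ) δ = Set.Icc (-δ) δ := by
    apply Set.inter_eq_right.mpr
    intro x hx
    exact ⟨by linarith [hx.1], by linarith [hx.2]⟩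
  rw [hs]
  simp
  rw [max_eq_left (by linarith)]; ring

lemma integral_indD_nat (δ : ℝ) (h0 : 0 ≤ δ) (h1 : δ < 1 / 2) (n : ℕ) (hn : n ≠ 0) :
    ∫ x in (0:ℝ)..1, indD δ (x * n) = 2 * δ := by
  have hn' : (n : ℝ) ≠ 0 := by exact_mod_cast hn
  rw [intervalIntegral.integral_comp_mul_right (fun x => indD δ x) hn']
  have hp := (indD_periodic δ).intervalIntegral_add_zsmul_eq (n : ℤ) 0
    (fun u v => by simpa using integrable_indD_comp δ 1 u v)
  simp only [zero_add, zsmul_eq_mul, mul_one, Int.cast_natCast] at hp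
  rw [zero_mul, one_mul, hp, integral_indD_one δ h0 h1, smul_eq_mul]
  field_simp

lemma indD_neg (δ x : ℝ) : indD δ (-x) = indD δ x := by
  have : intDist (-x) = intDist x := by
    unfold intDist
    rw [abs_sub_round_eq_min, abs_sub_round_eq_min]
    by_cases hx : Int.fract x = 0
    · have : Int.fract (-x) = 0 := by rwa [Int.fract_neg_eq_zero]
      rw [hx, this]
    · rw [Int.fract_neg hx, min_comm]; congr 1; ring
  unfold indD; rw [this]

lemma integral_indD_diff (δ : ℝ) (h0 : 0 ≤ δ) (h1 : δ < 1 / 2) (m n : ℕ) (hn : m ≠ n) :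
    ∫ x in (0:ℝ)..1, indD δ (x * ((m:ℝ) - n)) = 2 * δ := by
  rcases lt_or_gt_of_ne hn with h | h
  · rw [← integral_indD_nat δ h0 h1 (n - m) (by omega)]
    congr 1; funext x
    rw [← indD_neg, Nat.cast_sub h.le]; congr 1; ring
  · rw [← integral_indD_nat δ h0 h1 (m - n) (by omega)]
    congr 1; funext x
    rw [Nat.cast_sub h.le]

/-- off-diagonal pairs -/
noncomputable def offP (N : ℕ) : Finset (ℕ × ℕ) :=
  (Finset.Icc 1 N ×ˢ Finset.Icc 1 N).filter (fun p => p.1 ≠ p.2)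

noncomputable def sumD (a : ℕ → ℕ) (S : Finset (ℕ × ℕ)) (δ α : ℝ) : ℝ :=
  ∑ p ∈ S, indD δ (α * ((a p.1 : ℝ) - (a p.2 : ℝ)))

lemma pairCorr_eq (a : ℕ → ℕ) (α s : ℝ) (N : ℕ) :
    pairCorr a α s N = sumD a (offP N) (s / N) α / N := by
  unfold pairCorr sumD offP indD
  rw [Finset.sum_boole, Finset.filter_filter]

lemma integrable_sumD (a : ℕ → ℕ) (S : Finset (ℕ × ℕ)) (δ : ℝ) :
    IntervalIntegrable (sumD a S δ) volume 0 1 := by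
  have : sumD a S δ = ∑ p ∈ S, fun α => indD δ (α * ((a p.1 : ℝ) - (a p.2 : ℝ))) := by
    funext α; simp [sumD]
  rw [this]
  exact IntervalIntegrable.sum _ fun p _ => integrable_indD_comp _ _ _ _

lemma integral_sumD (a : ℕ → ℕ) (ha : StrictMono a) (N : ℕ) (S : Finset (ℕ × ℕ))
    (hS : S ⊆ offP N) (δ : ℝ) (h0 : 0 ≤ δ) (h1 : δ < 1 / 2) :
    ∫ α in (0:ℝ)..1, sumD a S δ α = S.card * (2 * δ) := by
  unfold sumD
  rw [intervalIntegral.integral_finsetSum (fun p _ => integrable_indD_comp _ _ _ _)]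
  rw [Finset.sum_congr rfl (g := fun _ => 2 * δ), Finset.sum_const, nsmul_eq_mul]
  intro p hp
  have := hS hp
  simp only [offP, Finset.mem_filter] at this
  exact integral_indD_diff δ h0 h1 _ _ (fun h => this.2 (ha.injective h))

/-- pairs with the same difference as `p` -/
noncomputable def rep (a : ℕ → ℕ) (N : ℕ) (p : ℕ × ℕ) : Finset (ℕ × ℕ) :=
  (Finset.Icc 1 N ×ˢ Finset.Icc 1 N).filter (fun q => (a q.1 : ℤ) - a q.2 = a p.1 - a p.2)

lemma card_rep_le (a : ℕ → ℕ) (ha : StrictMono a) (N : ℕ) (p : ℕ × ℕ) :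
    (rep a N p).card ≤ N := by
  have : (rep a N p).card ≤ (Finset.Icc 1 N).card := by
    apply Finset.card_le_card_of_injOn Prod.fst
    · intro q hq
      simp only [rep, Finset.coe_filter, Set.mem_ofPred_eq, Finset.mem_product] at hq
      exact hq.1.1
    · intro q hq q' hq' h
      simp only [rep, Finset.coe_filter, Set.mem_ofPred_eq, Finset.mem_product] at hq hq'
      have h2 : a q.2 = a q'.2 := by
        have h1 := hq.2; have h2 := hq'.2
        rw [h] at h1; omega
      exact Prod.ext h (ha.injective h2)
  simpa using this

lemma energy_le (a : ℕ → ℕ) (N : ℕ) :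
    _root_.addEnergy (firstN a N) ≤ ∑ p ∈ Finset.Icc 1 N ×ˢ Finset.Icc 1 N, (rep a N p).card := by
  rw [← Finset.card_sigma]
  unfold _root_.addEnergy
  refine Finset.card_le_card_of_surjOn
    (fun x : (Σ _ : ℕ × ℕ, ℕ × ℕ) => (a x.1.1, a x.2.2, a x.1.2, a x.2.1)) ?_
  intro q hq
  obtain ⟨b1, b2, b3, b4⟩ := q
  simp only [firstN, Finset.coe_filter, Set.mem_ofPred_eq, Finset.mem_product,
    Finset.mem_image] at hq
  obtain ⟨⟨⟨i, hi, rfl⟩, ⟨j, hj, rfl⟩, ⟨k, hk, rfl⟩, ⟨l, hl, rfl⟩⟩, he⟩ := hq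
  refine ⟨⟨(i, k), (l, j)⟩, ?_, rfl⟩
  simp only [rep, Finset.coe_sigma, Set.mem_sigma_iff, Finset.mem_coe, Finset.mem_product,
    Finset.mem_filter]
  refine ⟨⟨hi, hk⟩, ⟨hl, hj⟩, ?_⟩
  omega

noncomputable def goodP (a : ℕ → ℕ) (κ : ℝ) (N : ℕ) : Finset (ℕ × ℕ) :=
  (offP N).filter (fun p => κ * N ≤ (rep a N p).card)

lemma energy_le_good (a : ℕ → ℕ) (ha : StrictMono a) (κ : ℝ) (hκ : 0 ≤ κ) (N : ℕ) :
    (_root_.addEnergy (firstN a N) : ℝ) ≤ (N:ℝ)^2 + κ * N^3 + N * (goodP a κ N).card := by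
  have h1 : (_root_.addEnergy (firstN a N) : ℝ) ≤
      ∑ p ∈ Finset.Icc 1 N ×ˢ Finset.Icc 1 N, ((rep a N p).card : ℝ) := by
    exact_mod_cast energy_le a N
  have h2 : ∀ p ∈ Finset.Icc 1 N ×ˢ Finset.Icc 1 N, ((rep a N p).card : ℝ) ≤
      (if p.1 = p.2 then (N:ℝ) else 0) + κ * N + (if p ∈ goodP a κ N then (N:ℝ) else 0) := by
    intro p hp
    have hr : ((rep a N p).card : ℝ) ≤ N := by exact_mod_cast card_rep_le a ha N p
    have hk : 0 ≤ κ * N := by positivity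
    have hN : (0:ℝ) ≤ N := by positivity
    by_cases hd : p.1 = p.2
    · rw [if_pos hd]; split_ifs <;> linarith
    · rw [if_neg hd]
      by_cases hg : p ∈ goodP a κ N
      · rw [if_pos hg]; linarith
      · rw [if_neg hg]
        have : ¬ (κ * N ≤ (rep a N p).card) := fun h => hg (by
          simp only [goodP, offP, Finset.mem_filter]; exact ⟨⟨hp, hd⟩, h⟩)
        linarith
  refine h1.trans ((Finset.sum_le_sum h2).trans ?_)
  rw [Finset.sum_add_distrib, Finset.sum_add_distrib]
  have e1 : ∑ p ∈ Finset.Icc 1 N ×ˢ Finset.Icc 1 N, (if p.1 = p.2 then (N:ℝ) else 0)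
      = (N:ℝ)^2 := by
    rw [Finset.sum_product]
    have : ∀ x ∈ Finset.Icc 1 N, ∑ y ∈ Finset.Icc 1 N, (if x = y then (N:ℝ) else 0) = N := by
      intro x hx; rw [Finset.sum_ite_eq, if_pos hx]
    rw [Finset.sum_congr rfl this]; simp [sq]
  have e2 : ∑ p ∈ Finset.Icc 1 N ×ˢ Finset.Icc 1 N, κ * (N:ℝ) = κ * N^3 := by
    simp; ring
  have e3 : ∑ p ∈ Finset.Icc 1 N ×ˢ Finset.Icc 1 N, (if p ∈ goodP a κ N then (N:ℝ) else 0)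
      = N * (goodP a κ N).card := by
    rw [← Finset.sum_filter, Finset.sum_const, nsmul_eq_mul, mul_comm]
    congr 3
    ext p
    simp only [goodP, offP, Finset.mem_filter]
    tauto
  rw [e1, e2, e3]

lemma good_subset (a : ℕ → ℕ) (κ : ℝ) (N : ℕ) : goodP a κ N ⊆ offP N :=
  Finset.filter_subset _ _

lemma sumD_mono (a : ℕ → ℕ) {S T : Finset (ℕ × ℕ)} (h : S ⊆ T) (δ α : ℝ) :
    sumD a S δ α ≤ sumD a T δ α :=
  Finset.sum_le_sum_of_subset_of_nonneg h fun _ _ _ => indD_nonneg _ _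

/-- The key pointwise bound. -/
lemma good_bound (a : ℕ → ℕ) (ha : StrictMono a) (κ s α : ℝ) (hs : 0 ≤ s) (hκ : 4 * s ≤ κ) (N : ℕ)
    (hN : 0 < N) :
    sumD a (goodP a κ N) (s / N) α / N ≤ 2 * max (pairCorr a α s N - 2 * s) 0 := by
  have hN' : (0:ℝ) < N := by exact_mod_cast hN
  by_cases hz : ∃ p ∈ goodP a κ N, indD (s / N) (α * ((a p.1 : ℝ) - (a p.2 : ℝ))) ≠ 0
  · obtain ⟨p, hp, hpz⟩ := hz
    have hle : sumD a (goodP a κ N) (s / N) α / N ≤ pairCorr a α s N := by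
      rw [pairCorr_eq]
      gcongr
      exact sumD_mono a (good_subset a κ N) _ _
    have hF : κ ≤ pairCorr a α s N := by
      simp only [goodP, offP, Finset.mem_filter] at hp
      have hd : intDist (α * ((a p.1 : ℝ) - (a p.2 : ℝ))) ≤ s / N := by
        by_contra hc
        exact hpz (by unfold indD; rw [if_neg hc])
      unfold pairCorr
      rw [le_div_iff₀ hN']
      refine hp.2.trans ?_
      refine Nat.cast_le.mpr ?_
      apply Finset.card_le_card
      intro q hq
      simp only [rep, Finset.mem_filter] at hq
      rw [Finset.mem_filter]
      have hdiff : (a q.1 : ℝ) - a q.2 = a p.1 - a p.2 := by exact_mod_cast hq.2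
      refine ⟨hq.1, ?_, ?_⟩
      · intro hqq
        rw [hqq, sub_self] at hq
        have h0 : (a p.1 : ℤ) = a p.2 := by linarith [hq.2]
        exact hp.1.2 (ha.injective (by exact_mod_cast h0))
      · rw [hdiff]; exact hd
    have := le_max_left (pairCorr a α s N - 2 * s) 0
    linarith
  · push Not at hz
    have : sumD a (goodP a κ N) (s / N) α = 0 := Finset.sum_eq_zero hz
    rw [this, zero_div]
    positivity

lemma integral_good_le (a : ℕ → ℕ) (ha : StrictMono a) (κ s : ℝ) (hs : 0 < s)
    (hκ : 4 * s ≤ κ) (N : ℕ) (hN : 2 * s < N) :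
    (goodP a κ N).card * (2 * (s / N)) / N ≤
      2 * ∫ α in (0:ℝ)..1, max (2 * s - pairCorr a α s N) 0 := by
  have hN' : (0:ℝ) < N := by linarith
  have hN0 : 0 < N := by exact_mod_cast hN'
  have h0 : 0 ≤ s / N := by positivity
  have h1 : s / N < 1 / 2 := by rw [div_lt_iff₀ hN']; linarith
  have iF : IntervalIntegrable (fun α => pairCorr a α s N) volume 0 1 := by
    simp only [pairCorr_eq]; exact (integrable_sumD a _ _).div_const _
  have iC : IntervalIntegrable (fun _ : ℝ => 2 * s) volume 0 1 := intervalIntegrable_const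
  have iM : IntervalIntegrable (fun α => max (2 * s - pairCorr a α s N) 0) volume 0 1 := by
    have := (iC.sub iF)
    rw [intervalIntegrable_iff] at this ⊢
    exact this.pos_part
  have iG := (integrable_sumD a (goodP a κ N) (s / N)).div_const (N:ℝ)
  have hle : ∫ α in (0:ℝ)..1, sumD a (goodP a κ N) (s / N) α / N ≤
      ∫ α in (0:ℝ)..1, 2 * ((pairCorr a α s N - 2 * s) + max (2 * s - pairCorr a α s N) 0) := by
    apply intervalIntegral.integral_mono_on (by norm_num) iG (((iF.sub iC).add iM).const_mul 2)
    intro α _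
    refine (good_bound a ha κ s α hs.le hκ N hN0).trans (le_of_eq ?_)
    congr 1
    rcases le_total (2 * s) (pairCorr a α s N) with h | h
    · rw [max_eq_left (by linarith), max_eq_right (by linarith)]; ring
    · rw [max_eq_right (by linarith), max_eq_left (by linarith)]; ring
  rw [intervalIntegral.integral_div, integral_sumD a ha N _ (good_subset a κ N) _ h0 h1,
    intervalIntegral.integral_const_mul, intervalIntegral.integral_add (iF.sub iC) iM,
    intervalIntegral.integral_sub iF iC] at hle
  have hF : ∫ α in (0:ℝ)..1, pairCorr a α s N ≤ 2 * s := by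
    simp only [pairCorr_eq]
    rw [intervalIntegral.integral_div, integral_sumD a ha N _ subset_rfl _ h0 h1,
      div_le_iff₀ hN']
    have hc : ((offP N).card : ℝ) ≤ N * N := by
      have : (offP N).card ≤ N * N := by
        refine (Finset.card_filter_le _ _).trans ?_
        simp
      exact_mod_cast this
    calc ((offP N).card : ℝ) * (2 * (s / N)) ≤ (N * N) * (2 * (s / N)) := by gcongr
      _ = 2 * s * N := by field_simp
  have hC : ∫ _ in (0:ℝ)..1, 2 * s = 2 * s := by simp
  rw [hC] at hle
  linarith

lemma tendsto_defect (a : ℕ → ℕ) (s : ℝ) (hs : 0 < s) (hP : MetricPoissonian a) :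
    Tendsto (fun N : ℕ => ∫ α in (0:ℝ)..1, max (2 * s - pairCorr a α s N) 0) atTop (nhds 0) := by
  have hz : ∫ _ in (0:ℝ)..1, (0:ℝ) = 0 := by simp
  refine Tendsto.mono_right (y := nhds (∫ _ in (0:ℝ)..1, (0:ℝ))) ?_ (le_of_eq (by rw [hz]))
  refine intervalIntegral.tendsto_integral_filter_of_dominated_convergence
    (fun _ => 2 * s) ?_ ?_ (intervalIntegrable_const (μ := volume)) ?_
  · refine Eventually.of_forall fun N => ?_
    have iF : IntervalIntegrable (fun α => pairCorr a α s N) volume 0 1 := by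
      simp only [pairCorr_eq]; exact (integrable_sumD a _ _).div_const _
    have iC : IntervalIntegrable (fun _ : ℝ => 2 * s) volume 0 1 := intervalIntegrable_const
    have := (iC.sub iF)
    rw [intervalIntegrable_iff] at this
    exact this.pos_part.aestronglyMeasurable
  · refine Eventually.of_forall fun N => Eventually.of_forall fun α _ => ?_
    have hp : 0 ≤ pairCorr a α s N := by unfold pairCorr; positivity
    rw [Real.norm_eq_abs, abs_of_nonneg (le_max_right _ _)]
    exact max_le (by linarith) (by linarith)
  · unfold MetricPoissonian at hP
    rw [ae_restrict_iff' measurableSet_Icc] at hP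
    filter_upwards [hP] with α hα hm
    rw [Set.uIoc_of_le (by norm_num)] at hm
    have ht := hα ⟨hm.1.le, hm.2⟩ s hs
    have := ((tendsto_const_nhds (x := 2 * s)).sub ht).max (tendsto_const_nhds (x := (0:ℝ)))
    simpa using this

/-- **(Bourgain)** If `limsup_{N→∞} E(A_N)/N³ > 0` then `𝒜` is not metric Poissonian. -/
theorem not_metricPoissonian_of_large_energy (a : ℕ → ℕ) (ha : StrictMono a)
    (h : 0 < Filter.limsup (fun N : ℕ => (addEnergy (firstN a N) : ℝ) / (N : ℝ) ^ 3) atTop) :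
    ¬ MetricPoissonian a := by
  intro hP
  obtain ⟨c, hc0, hcl⟩ := exists_between h
  have hfreq : ∃ᶠ N : ℕ in atTop, c < (addEnergy (firstN a N) : ℝ) / (N : ℝ) ^ 3 := by
    refine Filter.frequently_lt_of_lt_limsup ?_ hcl
    exact Filter.IsBoundedUnder.isCoboundedUnder_le
      ⟨0, Filter.eventually_map.mpr (Eventually.of_forall fun N => by positivity)⟩
  have hs : 0 < c / 8 := by positivity
  have ht := tendsto_defect a (c / 8) hs hP
  have hev := ht.eventually (gt_mem_nhds (show (0:ℝ) < (c / 8) * c / 4 by positivity))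
  have hlarge : ∀ᶠ N : ℕ in atTop, max 1 (max (c / 4) (4 / c)) < (N:ℝ) :=
    tendsto_natCast_atTop_atTop.eventually_gt_atTop _
  obtain ⟨N, hN, hlt, hbig⟩ := (hfreq.and_eventually (hev.and hlarge)).exists
  have hN1 : (1:ℝ) < N := lt_of_le_of_lt (le_max_left _ _) hbig
  have hN2 : c / 4 < N :=
    lt_of_le_of_lt ((le_max_left _ _).trans (le_max_right _ _)) hbig
  have hN3 : 4 / c < N :=
    lt_of_le_of_lt ((le_max_right _ _).trans (le_max_right _ _)) hbig
  have hNp : (0:ℝ) < N := by linarith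
  rw [lt_div_iff₀ (by positivity)] at hN
  rw [div_lt_iff₀ hc0] at hN3
  have hE := energy_le_good a ha (c / 2) (by positivity) N
  have hI := integral_good_le a ha (c / 2) (c / 8) hs (by linarith) N (by linarith)
  -- |P| ≥ c/4 N^2
  have hP' : c / 4 * (N:ℝ)^2 < (goodP a (c / 2) N).card := by
    have : N * (c / 4 * (N:ℝ)^2) < N * ((goodP a (c / 2) N).card : ℝ) := by
      nlinarith [mul_lt_mul_of_pos_right hN3 (show (0:ℝ) < N^2 by positivity)]
    exact lt_of_mul_lt_mul_left this hNp.le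
  have hG : c / 4 * (2 * (c / 8)) < (goodP a (c / 2) N).card * (2 * (c / 8 / N)) / N := by
    have : ((goodP a (c / 2) N).card : ℝ) * (2 * (c / 8 / N)) / N
      = (goodP a (c / 2) N).card * (2 * (c / 8)) / N^2 := by field_simp
    rw [this, lt_div_iff₀ (by positivity)]
    nlinarith
  linarith
end

section
/- Let P_N denote the set of the first N prime numbers. Then E(P_N) ≍ N³/log N; that is, there exist constants c₁, c₂ > 0 such that for all N ≥ 2, c₁·N³/log N ≤ E(P_N) ≤ c₂·N³/log N. -/
open MeasureTheory Filter Finset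
open scoped Classical

/-- Chinese remainder theorem for sums of products of periodic functions. -/
lemma crt_sum {m k : ℕ} (hm : 0 < m) (hk : 0 < k) (hc : m.Coprime k) (F G : ℕ → ℝ)
    (hF : Function.Periodic F m) (hG : Function.Periodic G k) :
    ∑ n ∈ range (m * k), F n * G n = (∑ n ∈ range m, F n) * (∑ n ∈ range k, G n) := by
  rw [Finset.sum_mul_sum, ← Finset.sum_product']
  refine Finset.sum_nbij (fun n => (n % m, n % k)) ?_ ?_ ?_ ?_
  · intro n hn
    simp [Nat.mod_lt _ hm, Nat.mod_lt _ hk]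
  · intro a ha b hb hab
    simp only [Prod.mk.injEq] at hab
    have h1 : a ≡ b [MOD m * k] := (Nat.modEq_and_modEq_iff_modEq_mul hc).1 ⟨hab.1, hab.2⟩
    simp only [coe_range, Set.mem_Iio] at ha hb
    exact Nat.ModEq.eq_of_lt_of_lt h1 ha hb
  · rintro ⟨a, b⟩ hab
    simp only [coe_product, coe_range, Set.mem_prod, Set.mem_Iio] at hab
    refine ⟨Nat.chineseRemainder hc a b, ?_, ?_⟩
    · simpa using Nat.chineseRemainder_lt_mul hc a b hm.ne' hk.ne'
    · have := (Nat.chineseRemainder hc a b).2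
      simp only [Prod.mk.injEq]
      exact ⟨Eq.trans this.1 (Nat.mod_eq_of_lt hab.1), Eq.trans this.2 (Nat.mod_eq_of_lt hab.2)⟩
  · intro n hn
    simp only
    rw [hF.map_mod_nat, hG.map_mod_nat]

lemma periodic_prod (S : Finset ℕ) (g : ℕ → ℕ → ℝ) (hg : ∀ p ∈ S, Function.Periodic (g p) p) :
    Function.Periodic (fun n => ∏ p ∈ S, g p n) (∏ p ∈ S, p) := by
  intro n
  refine Finset.prod_congr rfl fun p hp => ?_
  obtain ⟨c, hc⟩ := Finset.dvd_prod_of_mem (fun p : ℕ => p) hp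
  rw [hc, mul_comm p c]
  exact (hg p hp).nat_mul c n

lemma crt_prod (S : Finset ℕ) (hS : ∀ p ∈ S, p.Prime) (g : ℕ → ℕ → ℝ)
    (hg : ∀ p ∈ S, Function.Periodic (g p) p) :
    ∑ n ∈ range (∏ p ∈ S, p), ∏ p ∈ S, g p n = ∏ p ∈ S, ∑ n ∈ range p, g p n := by
  induction S using Finset.induction_on with
  | empty => simp
  | insert a S ha ih =>
    simp only [Finset.prod_insert ha]
    rw [← ih (fun p hp => hS p (mem_insert_of_mem hp)) (fun p hp => hg p (mem_insert_of_mem hp))]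
    refine crt_sum (hS a (mem_insert_self _ _)).pos
      (Finset.prod_pos fun p hp => (hS p (mem_insert_of_mem hp)).pos) ?_ _ _
      (hg a (mem_insert_self _ _)) (periodic_prod S g fun p hp => hg p (mem_insert_of_mem hp))
    refine Nat.Coprime.prod_right fun p hp => ?_
    refine (Nat.coprime_primes (hS a (mem_insert_self _ _)) (hS p (mem_insert_of_mem hp))).2 ?_
    rintro rfl
    exact ha hp

lemma periodic_sum_mul (P : ℕ) (g : ℕ → ℝ) (hg : Function.Periodic g P) (k : ℕ) :
    ∑ n ∈ range (P * k), g n = k * ∑ n ∈ range P, g n := by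
  induction k with
  | zero => simp
  | succ k ih =>
    rw [Nat.mul_succ, Finset.sum_range_add, ih]
    have : ∀ n ∈ range P, g (P * k + n) = g n := fun n _ => by
      rw [add_comm, mul_comm]
      exact hg.nat_mul k n
    rw [Finset.sum_congr rfl this]
    push_cast
    ring

lemma periodic_sum_le (P : ℕ) (hP : 0 < P) (g : ℕ → ℝ) (hg : Function.Periodic g P)
    (hb : ∀ n, g n ≤ 1) (X : ℕ) (h : ℝ) (hh : 0 ≤ h) (hA : ∑ n ∈ range P, g n = P * h) :
    ∑ n ∈ range X, g n ≤ X * h + P := by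
  have hX := Nat.div_add_mod X P
  conv_lhs => rw [← hX]
  rw [Finset.sum_range_add, periodic_sum_mul P g hg, hA]
  have h1 : ∑ n ∈ range (X % P), g (P * (X / P) + n) ≤ P := by
    calc _ ≤ ∑ n ∈ range (X % P), (1 : ℝ) := Finset.sum_le_sum fun n _ => hb _
      _ = (X % P : ℕ) := by simp
      _ ≤ P := by exact_mod_cast (Nat.mod_lt X hP).le
  have h2 : ((X / P : ℕ) : ℝ) * (P * h) ≤ X * h := by
    rw [← mul_assoc]
    refine mul_le_mul_of_nonneg_right ?_ hh
    exact_mod_cast Nat.div_mul_le_self X P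
  linarith

/-- The local sieve weight at the prime `p`, for the two residue classes `0` and `n`. -/
noncomputable def sw (n p b : ℕ) : ℝ :=
  if b % p = 0 ∨ b % p = n % p then -1 else 2 / ((p : ℝ) - 2)

lemma sw_periodic (n p : ℕ) : Function.Periodic (sw n p) p := by
  intro b
  simp [sw]

lemma sw_abs_le (n p b : ℕ) (hp : 5 ≤ p) : |sw n p b| ≤ 1 := by
  have : (5 : ℝ) ≤ p := by exact_mod_cast hp
  unfold sw
  split_ifs
  · simp
  · rw [abs_of_nonneg (by apply div_nonneg <;> linarith), div_le_one (by linarith)]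
    linarith

lemma sw_card (n p : ℕ) (hp : 5 ≤ p) :
    (range p).filter (fun b => b % p = 0 ∨ b % p = n % p) = {0, n % p} := by
  ext b
  have h0 : n % p < p := Nat.mod_lt _ (by omega)
  simp only [mem_filter, mem_range, mem_insert, mem_singleton]
  constructor
  · rintro ⟨h1, h2⟩
    rwa [Nat.mod_eq_of_lt h1] at h2
  · rintro (rfl | rfl)
    · simp; omega
    · simp [h0]

lemma sw_sum_gen (n p : ℕ) (hp : 5 ≤ p) (hn : ¬ p ∣ n) (a c : ℝ) :
    ∑ b ∈ range p, (if b % p = 0 ∨ b % p = n % p then a else c) = 2 * a + (p - 2) * c := by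
  have h0 : (0 : ℕ) ≠ n % p := fun h => hn (Nat.dvd_of_mod_eq_zero h.symm)
  have hc : ((range p).filter (fun b => b % p = 0 ∨ b % p = n % p)).card = 2 := by
    rw [sw_card n p hp, Finset.card_pair h0]
  have hc2 := Finset.card_filter_add_card_filter_not (s := range p)
    (fun b => b % p = 0 ∨ b % p = n % p)
  rw [hc, card_range] at hc2
  rw [Finset.sum_ite, Finset.sum_const, Finset.sum_const, hc, nsmul_eq_mul, nsmul_eq_mul]
  have : (((range p).filter (fun b => ¬(b % p = 0 ∨ b % p = n % p))).card : ℝ) = p - 2 := by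
    rw [eq_sub_iff_add_eq, add_comm]
    exact_mod_cast hc2
  rw [this]
  norm_num

lemma sw_sum (n p : ℕ) (hp : 5 ≤ p) (hn : ¬ p ∣ n) : ∑ b ∈ range p, sw n p b = 0 := by
  unfold sw
  rw [sw_sum_gen n p hp hn]
  have : (5 : ℝ) ≤ p := by exact_mod_cast hp
  have : (p : ℝ) - 2 ≠ 0 := by linarith
  field_simp
  norm_num

lemma sw_sum_sq (n p : ℕ) (hp : 5 ≤ p) (hn : ¬ p ∣ n) :
    ∑ b ∈ range p, sw n p b * sw n p b = p * (2 / ((p : ℝ) - 2)) := by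
  have : ∀ b, sw n p b * sw n p b = if b % p = 0 ∨ b % p = n % p then 1 else
    (2 / ((p : ℝ) - 2)) * (2 / ((p : ℝ) - 2)) := by
    intro b
    unfold sw
    split_ifs <;> simp
  simp_rw [this]
  rw [sw_sum_gen n p hp hn]
  have : (5 : ℝ) ≤ p := by exact_mod_cast hp
  have : (p : ℝ) - 2 ≠ 0 := by linarith
  field_simp
  ring

/-- The correlation of two sieve weights. -/
lemma sw_corr (n X : ℕ) (S T : Finset ℕ) (hS : ∀ p ∈ S, p.Prime ∧ 5 ≤ p ∧ ¬ p ∣ n)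
    (hT : ∀ p ∈ T, p.Prime ∧ 5 ≤ p ∧ ¬ p ∣ n) :
    ∑ b ∈ range X, (∏ p ∈ S, sw n p b) * (∏ p ∈ T, sw n p b) ≤
      X * (if S = T then ∏ p ∈ S, (2 / ((p : ℝ) - 2)) else 0) +
        ((∏ p ∈ S, p : ℕ) : ℝ) * ((∏ p ∈ T, p : ℕ) : ℝ) := by
  have hU : ∀ p ∈ S ∪ T, p.Prime ∧ 5 ≤ p ∧ ¬ p ∣ n := by
    intro p hp
    rcases mem_union.1 hp with h | h
    exacts [hS p h, hT p h]
  set g : ℕ → ℕ → ℝ := fun p b => (if p ∈ S then sw n p b else 1) * (if p ∈ T then sw n p b else 1)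
    with hgdef
  have hg : ∀ p, Function.Periodic (g p) p := by
    intro p b
    simp only [hgdef, sw_periodic n p b]
  have hprod : ∀ b, (∏ p ∈ S, sw n p b) * (∏ p ∈ T, sw n p b) = ∏ p ∈ S ∪ T, g p b := by
    intro b
    simp only [hgdef]
    rw [Finset.prod_mul_distrib, Finset.prod_ite_mem, Finset.prod_ite_mem,
      Finset.union_inter_cancel_left, Finset.union_inter_cancel_right]
  simp_rw [hprod]
  have hbd : ∀ b, ∏ p ∈ S ∪ T, g p b ≤ 1 := by
    intro b
    refine (le_abs_self _).trans ?_
    rw [Finset.abs_prod]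
    refine Finset.prod_le_one (fun p _ => abs_nonneg _) fun p hp => ?_
    have := sw_abs_le n p b (hU p hp).2.1
    simp only [hgdef, abs_mul]
    refine mul_le_one₀ ?_ (abs_nonneg _) ?_ <;> split_ifs <;> simp [this]
  have hpos : 0 < ∏ p ∈ S ∪ T, p := Finset.prod_pos fun p hp => (hU p hp).1.pos
  have hnn : ∀ p ∈ S, (0 : ℝ) ≤ 2 / ((p : ℝ) - 2) := by
    intro p hp
    have : (5 : ℝ) ≤ p := by exact_mod_cast (hS p hp).2.1
    apply div_nonneg <;> linarith
  have hmain := periodic_sum_le (∏ p ∈ S ∪ T, p) hpos (fun b => ∏ p ∈ S ∪ T, g p b)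
    (periodic_prod _ g fun p _ => hg p) hbd X
    (if S = T then ∏ p ∈ S, (2 / ((p : ℝ) - 2)) else 0)
    (by split_ifs; exacts [Finset.prod_nonneg hnn, le_rfl]) ?_
  · refine hmain.trans ?_
    gcongr
    have : ∏ p ∈ S ∪ T, p ≤ (∏ p ∈ S, p) * ∏ p ∈ T, p := by
      rw [← Finset.prod_union_inter]
      refine Nat.le_mul_of_pos_right _ (Finset.prod_pos fun p hp => ?_)
      exact (hS p (mem_inter.1 hp).1).1.pos
    exact_mod_cast this
  · rw [crt_prod _ (fun p hp => (hU p hp).1) g fun p _ => hg p]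
    split_ifs with h
    · subst h
      rw [Finset.union_self]
      push_cast
      rw [← Finset.prod_mul_distrib]
      refine Finset.prod_congr rfl fun p hp => ?_
      simp only [hgdef, hp, if_true]
      exact sw_sum_sq n p (hS p hp).2.1 (hS p hp).2.2
    · have : ∃ p ∈ S ∪ T, ¬ (p ∈ S ↔ p ∈ T) := by
        by_contra! hcon
        apply h
        ext p
        by_cases hp : p ∈ S ∪ T
        · exact hcon p hp
        · simp only [mem_union, not_or] at hp
          simp [hp.1, hp.2]
      obtain ⟨p, hp, hne⟩ := this
      rw [mul_zero]
      refine Finset.prod_eq_zero hp ?_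
      rw [← sw_sum n p (hU p hp).2.1 (hU p hp).2.2]
      refine Finset.sum_congr rfl fun b _ => ?_
      simp only [hgdef]
      by_cases h1 : p ∈ S <;> by_cases h2 : p ∈ T <;> simp_all

/-- Selberg's sieve for the residue classes `0` and `n`. -/
lemma selberg (n X : ℕ) (F : Finset (Finset ℕ)) (hF : ∀ S ∈ F, ∀ p ∈ S, p.Prime ∧ 5 ≤ p ∧ ¬ p ∣ n)
    (A : Finset ℕ) (hA : A ⊆ range X)
    (hgood : ∀ b ∈ A, ∀ S ∈ F, ∀ p ∈ S, ¬ (b % p = 0 ∨ b % p = n % p)) :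
    (A.card : ℝ) * (∑ S ∈ F, ∏ p ∈ S, (2 / ((p : ℝ) - 2))) ^ 2 ≤
      X * (∑ S ∈ F, ∏ p ∈ S, (2 / ((p : ℝ) - 2))) + (∑ S ∈ F, ((∏ p ∈ S, p : ℕ) : ℝ)) ^ 2 := by
  set L := ∑ S ∈ F, ∏ p ∈ S, (2 / ((p : ℝ) - 2)) with hL
  have h1 : (A.card : ℝ) * L ^ 2 = ∑ b ∈ A, (∑ S ∈ F, ∏ p ∈ S, sw n p b) ^ 2 := by
    rw [← nsmul_eq_mul, ← Finset.sum_const]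
    refine Finset.sum_congr rfl fun b hb => ?_
    congr 1
    refine Finset.sum_congr rfl fun S hS => Finset.prod_congr rfl fun p hp => ?_
    simp [sw, hgood b hb S hS p hp]
  have h2 : ∑ b ∈ A, (∑ S ∈ F, ∏ p ∈ S, sw n p b) ^ 2 ≤
      ∑ b ∈ range X, (∑ S ∈ F, ∏ p ∈ S, sw n p b) ^ 2 :=
    Finset.sum_le_sum_of_subset_of_nonneg hA fun _ _ _ => sq_nonneg _
  have h3 : ∑ b ∈ range X, (∑ S ∈ F, ∏ p ∈ S, sw n p b) ^ 2 =
      ∑ S ∈ F, ∑ T ∈ F, ∑ b ∈ range X, (∏ p ∈ S, sw n p b) * (∏ p ∈ T, sw n p b) := by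
    simp_rw [sq, Finset.sum_mul_sum]
    rw [Finset.sum_comm]
    refine Finset.sum_congr rfl fun S _ => ?_
    rw [Finset.sum_comm]
  have h4 : ∑ S ∈ F, ∑ T ∈ F, ∑ b ∈ range X, (∏ p ∈ S, sw n p b) * (∏ p ∈ T, sw n p b) ≤
      ∑ S ∈ F, ∑ T ∈ F, (X * (if S = T then ∏ p ∈ S, (2 / ((p : ℝ) - 2)) else 0) +
        ((∏ p ∈ S, p : ℕ) : ℝ) * ((∏ p ∈ T, p : ℕ) : ℝ)) :=
    Finset.sum_le_sum fun S hS => Finset.sum_le_sum fun T hT => sw_corr n X S T (hF S hS) (hF T hT)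
  rw [h1]
  refine h2.trans (h3.trans_le (h4.trans_eq ?_))
  simp_rw [Finset.sum_add_distrib]
  rw [sq, Finset.sum_mul_sum]
  congr 1
  simp_rw [← Finset.mul_sum]
  congr 1
  rw [hL]
  refine Finset.sum_congr rfl fun S hS => ?_
  simp [hS]

lemma sum_le_sum_inj {α β : Type*} (s : Finset α) (t : Finset β) (f : α → ℝ) (g : β → ℝ)
    (φ : α → β) (hm : ∀ a ∈ s, φ a ∈ t) (hi : Set.InjOn φ s) (hfg : ∀ a ∈ s, f a ≤ g (φ a))
    (hg : ∀ b ∈ t, 0 ≤ g b) : ∑ a ∈ s, f a ≤ ∑ b ∈ t, g b := by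
  calc ∑ a ∈ s, f a ≤ ∑ a ∈ s, g (φ a) := Finset.sum_le_sum hfg
    _ = ∑ b ∈ s.image φ, g b := (Finset.sum_image hi).symm
    _ ≤ ∑ b ∈ t, g b := Finset.sum_le_sum_of_subset_of_nonneg
        (Finset.image_subset_iff.2 hm) fun b hb _ => hg b hb

/-- The primes up to `Q`. -/
noncomputable def prs (Q : ℕ) : Finset ℕ := (range (Q + 1)).filter Nat.Prime

/-- Sets of primes outside `D` with product at most `Q`. -/
noncomputable def fam (D : Finset ℕ) (Q : ℕ) : Finset (Finset ℕ) :=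
  (prs Q \ D).powerset.filter (fun S => ∏ p ∈ S, p ≤ Q)

lemma mem_prs {Q p : ℕ} : p ∈ prs Q ↔ p ≤ Q ∧ p.Prime := by
  simp [prs]

lemma mem_fam {D : Finset ℕ} {Q : ℕ} {S : Finset ℕ} :
    S ∈ fam D Q ↔ (∀ p ∈ S, p.Prime ∧ p ∉ D) ∧ ∏ p ∈ S, p ≤ Q := by
  simp only [fam, mem_filter, mem_powerset]
  constructor
  · rintro ⟨h1, h2⟩
    refine ⟨fun p hp => ?_, h2⟩
    have := mem_sdiff.1 (h1 hp)
    exact ⟨(mem_prs.1 this.1).2, this.2⟩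
  · rintro ⟨h1, h2⟩
    refine ⟨fun p hp => ?_, h2⟩
    refine mem_sdiff.2 ⟨mem_prs.2 ⟨le_trans ?_ h2, (h1 p hp).1⟩, (h1 p hp).2⟩
    exact Nat.le_of_dvd (Finset.prod_pos fun q hq => (h1 q hq).1.pos)
      (Finset.dvd_prod_of_mem (fun p : ℕ => p) hp)

noncomputable def zz : ℝ := ∑' n : ℕ, 1 / (n : ℝ) ^ 2

noncomputable def kk : ℝ := Real.exp (8 * zz)

lemma sum_sq_le (T : Finset ℕ) : ∑ p ∈ T, 1 / (p : ℝ) ^ 2 ≤ zz :=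
  Summable.sum_le_tsum T (fun _ _ => by positivity)
    (Real.summable_one_div_nat_pow.2 (by norm_num))

lemma zz_nonneg : 0 ≤ zz := by simpa using sum_sq_le ∅

lemma kk_pos : 0 < kk := Real.exp_pos _

lemma prod_le_kk (T : Finset ℕ) (c : ℝ) (hc0 : 0 ≤ c) (hc : c ≤ 8) :
    ∏ p ∈ T, (1 + c / (p : ℝ) ^ 2) ≤ kk := by
  calc ∏ p ∈ T, (1 + c / (p : ℝ) ^ 2) ≤ ∏ p ∈ T, Real.exp (8 * (1 / (p : ℝ) ^ 2)) := by
        refine Finset.prod_le_prod (fun p _ => by positivity) fun p _ => ?_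
        rw [add_comm]
        refine (Real.add_one_le_exp _).trans (Real.exp_le_exp.2 ?_)
        rw [mul_one_div]
        gcongr
    _ = Real.exp (8 * ∑ p ∈ T, 1 / (p : ℝ) ^ 2) := by
        rw [← Real.exp_sum, Finset.mul_sum]
    _ ≤ kk := by
        refine Real.exp_le_exp.2 ?_
        have := sum_sq_le T
        linarith

lemma log_le_fam (y : ℕ) :
    Real.log (y + 1) ≤ zz * ∑ S ∈ fam ∅ y, ∏ p ∈ S, (1 / (p : ℝ)) := by
  have h1 : Real.log (y + 1) ≤ ∑ m ∈ Icc 1 y, 1 / (m : ℝ) := by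
    have := log_add_one_le_harmonic y
    rw [harmonic_eq_sum_Icc] at this
    push_cast at this
    simpa using this
  have h2 : ∀ m : ℕ, ∃ ab : ℕ × ℕ, 0 < m → 0 < ab.1 ∧ 0 < ab.2 ∧ ab.2 ^ 2 * ab.1 = m ∧
      Squarefree ab.1 := by
    intro m
    by_cases hm : 0 < m
    · obtain ⟨a, b, ha, hb, h⟩ := Nat.sq_mul_squarefree_of_pos hm
      exact ⟨(a, b), fun _ => ⟨ha, hb, h⟩⟩
    · exact ⟨(0, 0), fun h => absurd h hm⟩
  choose ab hab using h2
  have h3 : ∑ m ∈ Icc 1 y, 1 / (m : ℝ) ≤ ∑ x ∈ range (y + 1) ×ˢ fam ∅ y,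
      (1 / (x.1 : ℝ) ^ 2) * ∏ p ∈ x.2, (1 / (p : ℝ)) := by
    refine sum_le_sum_inj _ _ _ _ (fun m => ((ab m).2, (ab m).1.primeFactors)) ?_ ?_ ?_ ?_
    · intro m hm
      rw [mem_Icc] at hm
      obtain ⟨ha, hb, he, hs⟩ := hab m hm.1
      have h1 : (ab m).2 ≤ m := by
        calc (ab m).2 ≤ (ab m).2 ^ 2 * (ab m).1 := by nlinarith [Nat.mul_le_mul hb ha]
          _ = m := he
      have h2 : (ab m).1 ≤ m := by
        calc (ab m).1 ≤ (ab m).2 ^ 2 * (ab m).1 := Nat.le_mul_of_pos_left _ (by positivity)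
          _ = m := he
      simp only [mem_product, mem_range, mem_fam]
      refine ⟨by omega, fun p hp => ⟨Nat.prime_of_mem_primeFactors hp, by simp⟩, ?_⟩
      rw [Nat.prod_primeFactors_of_squarefree hs]
      omega
    · intro m hm m' hm' h
      simp only [coe_Icc, Set.mem_Icc] at hm hm'
      obtain ⟨ha, hb, he, hs⟩ := hab m hm.1
      obtain ⟨ha', hb', he', hs'⟩ := hab m' hm'.1
      simp only [Prod.mk.injEq] at h
      rw [← he, ← he', h.1, ← Nat.prod_primeFactors_of_squarefree hs,
        ← Nat.prod_primeFactors_of_squarefree hs', h.2]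
    · intro m hm
      rw [mem_Icc] at hm
      obtain ⟨ha, hb, he, hs⟩ := hab m hm.1
      simp only
      rw [Finset.prod_div_distrib, Finset.prod_const_one]
      have : ∏ p ∈ (ab m).1.primeFactors, (p : ℝ) = (ab m).1 := by
        rw [← Nat.cast_prod, Nat.prod_primeFactors_of_squarefree hs]
      rw [this, one_div_mul_one_div]
      conv_lhs => rw [← he]
      push_cast
      rfl
    · intro b _
      refine mul_nonneg (by positivity) (Finset.prod_nonneg fun _ _ => by positivity)
  rw [Finset.sum_product] at h3
  simp only [← Finset.mul_sum, ← Finset.sum_mul] at h3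
  refine h1.trans (h3.trans ?_)
  exact mul_le_mul_of_nonneg_right (sum_sq_le _)
    (Finset.sum_nonneg fun _ _ => Finset.prod_nonneg fun _ _ => by positivity)

lemma prop_aux (a b c d : Prop) (h1 : a ∧ b ↔ c ∧ d)
    (h2 : (a ∧ ¬ b) ∨ (b ∧ ¬ a) ↔ (c ∧ ¬ d) ∨ (d ∧ ¬ c)) (h3 : a ∧ ¬ b ↔ c ∧ ¬ d) :
    (a ↔ c) ∧ (b ↔ d) := by
  by_cases a <;> by_cases b <;> by_cases c <;> by_cases d <;> simp_all

lemma fam_sq_le (y : ℕ) :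
    (∑ S ∈ fam ∅ y, ∏ p ∈ S, (1 / (p : ℝ))) ^ 2 ≤
      kk * ∑ S ∈ fam ∅ (y ^ 2), ∏ p ∈ S, (2 / (p : ℝ)) := by
  have h1 : ∀ S : Finset ℕ, ∏ p ∈ S, (2 / (p : ℝ)) =
      ∑ T ∈ S.powerset, ∏ p ∈ S, (1 / (p : ℝ)) := by
    intro S
    rw [Finset.sum_const, Finset.card_powerset, Finset.prod_div_distrib, Finset.prod_div_distrib]
    simp [div_eq_mul_inv]
  have h2 : ∑ x ∈ fam ∅ y ×ˢ fam ∅ y, (∏ p ∈ x.1, (1 / (p : ℝ))) * ∏ p ∈ x.2, (1 / (p : ℝ)) ≤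
      ∑ z ∈ (prs y).powerset ×ˢ (fam ∅ (y ^ 2)).sigma (fun S => S.powerset),
        (∏ p ∈ z.1, (1 / (p : ℝ) ^ 2)) * ∏ p ∈ z.2.1, (1 / (p : ℝ)) := by
    refine sum_le_sum_inj _ _ _ _
      (fun x => (x.1 ∩ x.2, ⟨(x.1 \ x.2) ∪ (x.2 \ x.1), x.1 \ x.2⟩)) ?_ ?_ ?_ ?_
    · rintro ⟨A, B⟩ hx
      simp only [mem_product] at hx
      have hA := mem_fam.1 hx.1
      have hB := mem_fam.1 hx.2
      simp only [mem_product, mem_powerset, mem_sigma]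
      refine ⟨?_, ?_, Finset.subset_union_left⟩
      · intro p hp
        have := (mem_filter.1 hx.1).1
        exact (mem_sdiff.1 (mem_powerset.1 this (mem_inter.1 hp).1)).1
      · rw [mem_fam]
        constructor
        · intro p hp
          rcases mem_union.1 hp with h | h
          exacts [hA.1 p (mem_sdiff.1 h).1, hB.1 p (mem_sdiff.1 h).1]
        · rw [Finset.prod_union (disjoint_sdiff_sdiff), sq]
          refine Nat.mul_le_mul (le_trans ?_ hA.2) (le_trans ?_ hB.2)
          · exact Finset.prod_le_prod_of_subset_of_one_le' sdiff_subset
              fun p hp _ => (hA.1 p hp).1.one_le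
          · exact Finset.prod_le_prod_of_subset_of_one_le' sdiff_subset
              fun p hp _ => (hB.1 p hp).1.one_le
    · rintro ⟨A, B⟩ _ ⟨A', B'⟩ _ h
      simp only [Prod.mk.injEq, Sigma.mk.injEq, heq_eq_eq] at h
      obtain ⟨h1, h2, h3⟩ := h
      have k1 : ∀ p, (p ∈ A ∧ p ∈ B ↔ p ∈ A' ∧ p ∈ B') := fun p => by
        simpa using Finset.ext_iff.1 h1 p
      have k2 : ∀ p, ((p ∈ A ∧ p ∉ B) ∨ (p ∈ B ∧ p ∉ A) ↔ (p ∈ A' ∧ p ∉ B') ∨ (p ∈ B' ∧ p ∉ A')) :=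
        fun p => by simpa using Finset.ext_iff.1 h2 p
      have k3 : ∀ p, (p ∈ A ∧ p ∉ B ↔ p ∈ A' ∧ p ∉ B') := fun p => by
        simpa using Finset.ext_iff.1 h3 p
      simp only [Prod.mk.injEq]
      exact ⟨Finset.ext fun p => (prop_aux _ _ _ _ (k1 p) (k2 p) (k3 p)).1,
        Finset.ext fun p => (prop_aux _ _ _ _ (k1 p) (k2 p) (k3 p)).2⟩
    · rintro ⟨A, B⟩ _
      simp only
      rw [Finset.prod_union (disjoint_sdiff_sdiff)]
      have e1 : ∏ p ∈ A, (1 / (p : ℝ)) =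
          (∏ p ∈ A ∩ B, (1 / (p : ℝ))) * ∏ p ∈ A \ B, (1 / (p : ℝ)) :=
        (Finset.prod_inter_mul_prod_sdiff A B _).symm
      have e2 : ∏ p ∈ B, (1 / (p : ℝ)) =
          (∏ p ∈ A ∩ B, (1 / (p : ℝ))) * ∏ p ∈ B \ A, (1 / (p : ℝ)) := by
        rw [Finset.inter_comm]
        exact (Finset.prod_inter_mul_prod_sdiff B A _).symm
      have e3 : ∏ p ∈ A ∩ B, (1 / (p : ℝ) ^ 2) =
          (∏ p ∈ A ∩ B, (1 / (p : ℝ))) * (∏ p ∈ A ∩ B, (1 / (p : ℝ))) := by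
        rw [← Finset.prod_mul_distrib]
        refine Finset.prod_congr rfl fun p _ => ?_
        rw [one_div_mul_one_div, sq]
      rw [e1, e2, e3]
      apply le_of_eq
      ring
    · intro z _
      exact mul_nonneg (Finset.prod_nonneg fun _ _ => by positivity)
        (Finset.prod_nonneg fun _ _ => by positivity)
  rw [Finset.sum_product, Finset.sum_product] at h2
  simp only [← Finset.mul_sum, ← Finset.sum_mul, Finset.sum_sigma] at h2
  simp only [← h1] at h2
  rw [← Finset.prod_one_add] at h2
  rw [sq]
  refine h2.trans ?_
  exact mul_le_mul_of_nonneg_right (prod_le_kk _ 1 (by norm_num) (by norm_num))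
    (Finset.sum_nonneg fun _ _ => Finset.prod_nonneg fun _ _ => by positivity)

lemma fam_remove (D : Finset ℕ) (Q : ℕ) :
    ∑ S ∈ fam ∅ Q, ∏ p ∈ S, (2 / (p : ℝ)) ≤
      (∏ p ∈ D, (1 + 2 / (p : ℝ))) * ∑ S ∈ fam D Q, ∏ p ∈ S, (2 / (p : ℝ)) := by
  rw [Finset.prod_one_add, Finset.sum_mul_sum, ← Finset.sum_product']
  refine sum_le_sum_inj _ _ _ _ (fun S => (S ∩ D, S \ D)) ?_ ?_ ?_ ?_
  · intro S hS
    have h := mem_fam.1 hS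
    simp only [mem_product, mem_powerset, mem_fam]
    refine ⟨inter_subset_right, fun p hp => ⟨(h.1 p (mem_sdiff.1 hp).1).1, (mem_sdiff.1 hp).2⟩, ?_⟩
    refine le_trans ?_ h.2
    exact Finset.prod_le_prod_of_subset_of_one_le' sdiff_subset
      fun p hp _ => (h.1 p hp).1.one_le
  · intro S _ T _ h
    simp only [Prod.mk.injEq] at h
    rw [← Finset.sdiff_union_inter S D, ← Finset.sdiff_union_inter T D, h.1, h.2]
  · intro S _
    exact (Finset.prod_inter_mul_prod_sdiff S D _).ge
  · intro z _
    exact mul_nonneg (Finset.prod_nonneg fun _ _ => by positivity)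
        (Finset.prod_nonneg fun _ _ => by positivity)

lemma sum_H_le (Y : ℕ) :
    ∑ n ∈ Icc 1 Y, ∏ p ∈ n.primeFactors, (1 + 8 / (p : ℝ)) ≤ Y * kk := by
  have h1 : ∀ n ∈ Icc 1 Y, ∏ p ∈ n.primeFactors, (1 + 8 / (p : ℝ)) ≤
      ∑ S ∈ (prs Y).powerset, if ∏ p ∈ S, p ∣ n then ∏ p ∈ S, (8 / (p : ℝ)) else 0 := by
    intro n hn
    rw [mem_Icc] at hn
    rw [Finset.prod_one_add, ← Finset.sum_filter]
    refine Finset.sum_le_sum_of_subset_of_nonneg ?_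
      fun _ _ _ => Finset.prod_nonneg fun _ _ => by positivity
    intro S hS
    rw [mem_powerset] at hS
    rw [mem_filter, mem_powerset]
    constructor
    · intro p hp
      have := Nat.mem_primeFactors.1 (hS hp)
      exact mem_prs.2 ⟨(Nat.le_of_dvd (by omega) this.2.1).trans hn.2, this.1⟩
    · exact (Finset.prod_dvd_prod_of_subset _ _ _ hS).trans (Nat.prod_primeFactors_dvd n)
  refine (Finset.sum_le_sum h1).trans ?_
  rw [Finset.sum_comm]
  calc _ ≤ ∑ S ∈ (prs Y).powerset, (Y : ℝ) * ∏ p ∈ S, (8 / (p : ℝ) ^ 2) := by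
        refine Finset.sum_le_sum fun S hS => ?_
        rw [← Finset.sum_filter, Finset.sum_const, nsmul_eq_mul]
        have hc : ((Icc 1 Y).filter (fun n => ∏ p ∈ S, p ∣ n)).card = Y / ∏ p ∈ S, p := by
          have := Nat.Ioc_filter_dvd_card_eq_div Y (∏ p ∈ S, p)
          have e : Icc 1 Y = Ioc 0 Y := by
            ext
            simp only [mem_Icc, mem_Ioc]
            omega
          rw [e]
          convert! this
        rw [hc]
        have h2 : ((Y / ∏ p ∈ S, p : ℕ) : ℝ) ≤ Y / ∏ p ∈ S, (p : ℝ) := by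
          have := @Nat.cast_div_le ℝ _ _ _ Y (∏ p ∈ S, p)
          push_cast at this
          exact this
        have h3 : ∏ p ∈ S, (8 / (p : ℝ) ^ 2) = (∏ p ∈ S, (8 / (p : ℝ))) / ∏ p ∈ S, (p : ℝ) := by
          rw [← Finset.prod_div_distrib]
          refine Finset.prod_congr rfl fun p _ => ?_
          rw [div_div, sq]
        rw [h3]
        calc _ ≤ (Y / ∏ p ∈ S, (p : ℝ)) * ∏ p ∈ S, (8 / (p : ℝ)) :=
              mul_le_mul_of_nonneg_right h2 (Finset.prod_nonneg fun _ _ => by positivity)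
          _ = _ := by ring
    _ = Y * ∏ p ∈ prs Y, (1 + 8 / (p : ℝ) ^ 2) := by
        rw [Finset.prod_one_add, Finset.mul_sum]
    _ ≤ _ := mul_le_mul_of_nonneg_left (prod_le_kk _ 8 (by norm_num) le_rfl) (by positivity)

noncomputable def mm : ℝ := zz ^ 2 * kk

lemma mm_nonneg : 0 ≤ mm := mul_nonneg (sq_nonneg _) kk_pos.le

lemma fam_sum_prod_le (D : Finset ℕ) (Q : ℕ) :
    ∑ S ∈ fam D Q, ((∏ p ∈ S, p : ℕ) : ℝ) ≤ (Q : ℝ) ^ 2 := by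
  have hc : (fam D Q).card ≤ (Icc 1 Q).card := by
    refine Finset.card_le_card_of_injOn (fun S => ∏ p ∈ S, p) ?_ ?_
    · intro S hS
      have h := mem_fam.1 (mem_coe.1 hS)
      simp only [coe_Icc, Set.mem_Icc]
      exact ⟨Finset.prod_pos fun p hp => (h.1 p hp).1.pos, h.2⟩
    · intro S hS T hT hST
      have h := mem_fam.1 (mem_coe.1 hS)
      have h' := mem_fam.1 (mem_coe.1 hT)
      simp only at hST
      rw [← Nat.primeFactors_prod (fun p hp => (h.1 p hp).1),
        ← Nat.primeFactors_prod (fun p hp => (h'.1 p hp).1), hST]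
  rw [Nat.card_Icc, Nat.add_sub_cancel] at hc
  calc _ ≤ ∑ S ∈ fam D Q, (Q : ℝ) :=
        Finset.sum_le_sum fun S hS => by exact_mod_cast (mem_fam.1 hS).2
    _ = (fam D Q).card * (Q : ℝ) := by rw [Finset.sum_const, nsmul_eq_mul]
    _ ≤ Q * Q := by gcongr
    _ = _ := by ring

lemma G_nonneg (D : Finset ℕ) : 0 ≤ ∏ p ∈ D, (1 + 2 / (p : ℝ)) :=
  Finset.prod_nonneg fun _ _ => by positivity

lemma one_le_fam (D : Finset ℕ) (Q : ℕ) (hQ : 1 ≤ Q) :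
    1 ≤ ∑ S ∈ fam D Q, ∏ p ∈ S, (2 / (p : ℝ)) := by
  have h0 : (∅ : Finset ℕ) ∈ fam D Q := by
    rw [mem_fam]
    simpa using hQ
  have h1 : ∀ S ∈ fam D Q, 0 ≤ ∏ p ∈ S, (2 / (p : ℝ)) :=
    fun S _ => Finset.prod_nonneg fun _ _ => by positivity
  have := Finset.single_le_sum h1 h0
  simpa using this

/-- The upper bound sieve estimate. -/
lemma sieve_bound (n x y : ℕ) (hn : 0 < n) (hy : 0 < y) (A : Finset ℕ) (hA : A ⊆ range (x + 1))
    (hgood : ∀ b ∈ A, ∀ p, p.Prime → p ≤ y ^ 2 → ¬ (b % p = 0 ∨ b % p = n % p)) :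
    (A.card : ℝ) ≤ (x + 1) * ((∏ p ∈ {2, 3} ∪ n.primeFactors, (1 + 2 / (p : ℝ))) * mm /
      Real.log (y + 1) ^ 2) + ((y : ℝ) ^ 2) ^ 4 := by
  set D : Finset ℕ := {2, 3} ∪ n.primeFactors with hD
  set G := ∏ p ∈ D, (1 + 2 / (p : ℝ)) with hG
  set F := fam D (y ^ 2) with hF
  have hFp : ∀ S ∈ F, ∀ p ∈ S, p.Prime ∧ 5 ≤ p ∧ ¬ p ∣ n := by
    intro S hS p hp
    obtain ⟨h1, h2⟩ := (mem_fam.1 hS).1 p hp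
    simp only [hD, mem_union, mem_insert, mem_singleton, not_or, Nat.mem_primeFactors] at h2
    refine ⟨h1, ?_, fun h => h2.2 ⟨h1, h, hn.ne'⟩⟩
    by_contra! h5
    have := h1.two_le
    interval_cases p
    · exact h2.1.1 rfl
    · exact h2.1.2 rfl
    · exact absurd h1 (by norm_num)
  have hS := selberg n (x + 1) F hFp A hA (by
    intro b hb S hS p hp
    refine hgood b hb p (hFp S hS p hp).1 ?_
    have h := mem_fam.1 hS
    refine le_trans ?_ h.2
    exact Nat.le_of_dvd (Finset.prod_pos fun q hq => (h.1 q hq).1.pos)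
      (Finset.dvd_prod_of_mem (fun p : ℕ => p) hp))
  set L' := ∑ S ∈ F, ∏ p ∈ S, (2 / ((p : ℝ) - 2)) with hL'
  set L := ∑ S ∈ F, ∏ p ∈ S, (2 / (p : ℝ)) with hL
  have hLL : L ≤ L' := by
    refine Finset.sum_le_sum fun S hS => Finset.prod_le_prod (fun p _ => by positivity) fun p hp => ?_
    have : (5 : ℝ) ≤ p := by exact_mod_cast (hFp S hS p hp).2.1
    apply div_le_div_of_nonneg_left <;> linarith
  have hL1 : 1 ≤ L := one_le_fam D (y ^ 2) (Nat.one_le_pow _ _ hy)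
  have hE := fam_sum_prod_le D (y ^ 2)
  have hE0 : 0 ≤ ∑ S ∈ F, ((∏ p ∈ S, p : ℕ) : ℝ) := Finset.sum_nonneg fun _ _ => Nat.cast_nonneg _
  have hE2 : (∑ S ∈ F, ((∏ p ∈ S, p : ℕ) : ℝ)) ^ 2 ≤ ((y : ℝ) ^ 2) ^ 4 := by
    calc _ ≤ (((y ^ 2 : ℕ) : ℝ) ^ 2) ^ 2 := pow_le_pow_left₀ hE0 hE 2
      _ = _ := by push_cast; ring
  have hlog : 0 < Real.log (y + 1) := Real.log_pos (by
    have : (1 : ℝ) ≤ y := by exact_mod_cast hy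
    linarith)
  have hG0 : 0 ≤ G := G_nonneg D
  have hW : Real.log (y + 1) ^ 2 ≤ mm * (G * L) := by
    have h1 := pow_le_pow_left₀ hlog.le (log_le_fam y) 2
    rw [mul_pow] at h1
    have h2 := mul_le_mul_of_nonneg_left (fam_sq_le y) (sq_nonneg zz)
    have h3 := mul_le_mul_of_nonneg_left (fam_remove D (y ^ 2)) mm_nonneg
    rw [← mul_assoc] at h2
    exact h1.trans (h2.trans h3)
  clear_value G L L'
  have hinv : 1 / L ≤ G * mm / Real.log (y + 1) ^ 2 := by
    rw [div_le_div_iff₀ (by linarith) (by positivity)]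
    linarith
  have hL'0 : 0 < L' := by linarith
  have hmain : (A.card : ℝ) ≤ (x + 1) / L' + ((y : ℝ) ^ 2) ^ 4 := by
    have h1 : (A.card : ℝ) ≤ ((x + 1) * L' + ((y : ℝ) ^ 2) ^ 4) / L' ^ 2 := by
      rw [le_div_iff₀ (by positivity)]
      rw [Nat.cast_add, Nat.cast_one] at hS
      linarith
    have h2 : ((y : ℝ) ^ 2) ^ 4 / L' ^ 2 ≤ ((y : ℝ) ^ 2) ^ 4 :=
      div_le_self (by positivity) (one_le_pow₀ (by linarith))
    have h3 : ((x : ℝ) + 1) * L' / L' ^ 2 = (x + 1) / L' := by field_simp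
    rw [add_div, h3] at h1
    linarith
  refine hmain.trans ?_
  gcongr
  rw [div_eq_mul_one_div]
  refine mul_le_mul_of_nonneg_left (le_trans ?_ hinv) (by positivity)
  exact one_div_le_one_div_of_le (by linarith) hLL

lemma rep_bound (n x y : ℕ) (hn : 0 < n) (hy : 0 < y) (B : Finset ℕ)
    (hB : ∀ b ∈ B, b.Prime ∧ b ≤ x) :
    (((B ×ˢ B).filter (fun q => q.1 + q.2 = n)).card : ℝ) ≤
      (x + 1) * ((∏ p ∈ {2, 3} ∪ n.primeFactors, (1 + 2 / (p : ℝ))) * mm /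
      Real.log (y + 1) ^ 2) + 5 * (y : ℝ) ^ 8 := by
  set A := B.filter (fun b => y ^ 2 < b ∧ b ≤ n ∧ (n - b) ∈ B ∧ y ^ 2 < n - b) with hAdef
  have hs := sieve_bound n x y hn hy A (by
    intro b hb
    have := (hB b (mem_filter.1 hb).1).2
    rw [mem_range]
    omega) (by
    intro b hb p hp hpy
    rw [hAdef, mem_filter] at hb
    obtain ⟨h1, h2, h3, h4, h5⟩ := hb
    rintro (h | h)
    · have := (Nat.prime_dvd_prime_iff_eq hp (hB b h1).1).1 (Nat.dvd_of_mod_eq_zero h)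
      omega
    · have h6 : p ∣ n - b := (Nat.modEq_iff_dvd' h3).1 h
      have := (Nat.prime_dvd_prime_iff_eq hp (hB _ h4).1).1 h6
      omega)
  have hc : ((B ×ˢ B).filter (fun q => q.1 + q.2 = n)).card ≤
      A.card + 2 * (y ^ 2 + 1) := by
    calc _ ≤ (A ∪ (range (y ^ 2 + 1) ∪ (range (y ^ 2 + 1)).image (fun b => n - b))).card := by
          refine Finset.card_le_card_of_injOn (fun q => q.1) ?_ ?_
          · rintro ⟨a, b⟩ hq
            simp only [coe_filter, mem_product, Set.mem_ofPred_eq] at hq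
            obtain ⟨⟨ha, hb⟩, hab⟩ := hq
            simp only [coe_union, Set.mem_union, mem_coe]
            by_cases h1 : a ≤ y ^ 2
            · right; left
              rw [mem_range]; omega
            by_cases h2 : b ≤ y ^ 2
            · right; right
              rw [mem_image]
              exact ⟨b, by rw [mem_range]; omega, by omega⟩
            · left
              rw [hAdef, mem_filter]
              have : n - a = b := by omega
              rw [this]
              exact ⟨ha, by omega, by omega, hb, by omega⟩
          · rintro ⟨a, b⟩ hq ⟨a', b'⟩ hq' h
            simp only [coe_filter, mem_product, Set.mem_ofPred_eq] at hq hq' h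
            simp only [Prod.mk.injEq]
            omega
      _ ≤ A.card + ((range (y ^ 2 + 1)).card + ((range (y ^ 2 + 1)).image (fun b => n - b)).card) :=
          (card_union_le _ _).trans (Nat.add_le_add_left (card_union_le _ _) _)
      _ ≤ A.card + ((range (y ^ 2 + 1)).card + (range (y ^ 2 + 1)).card) := by
          have := Finset.card_image_le (s := range (y ^ 2 + 1)) (f := fun b => n - b)
          omega
      _ = _ := by rw [card_range]; ring
  have hc' : (((B ×ˢ B).filter (fun q => q.1 + q.2 = n)).card : ℝ) ≤
      A.card + 2 * ((y : ℝ) ^ 2 + 1) := by exact_mod_cast hc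
  have hy1 : (1 : ℝ) ≤ y := by exact_mod_cast hy
  have h8 : (1 : ℝ) ≤ (y : ℝ) ^ 8 := one_le_pow₀ hy1
  have h2 : (y : ℝ) ^ 2 ≤ (y : ℝ) ^ 8 := pow_le_pow_right₀ hy1 (by norm_num)
  have h9 : ((y : ℝ) ^ 2) ^ 4 = (y : ℝ) ^ 8 := by ring
  rw [h9] at hs
  linarith

lemma G_sq_le (n : ℕ) :
    (∏ p ∈ {2, 3} ∪ n.primeFactors, (1 + 2 / (p : ℝ))) ^ 2 ≤
      19 * ∏ p ∈ n.primeFactors, (1 + 8 / (p : ℝ)) := by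
  have hp : ∀ p ∈ {2, 3} ∪ n.primeFactors, 1 ≤ p := by
    intro p hp
    simp only [mem_union, mem_insert, mem_singleton] at hp
    rcases hp with (rfl | rfl) | h
    · norm_num
    · norm_num
    · exact (Nat.prime_of_mem_primeFactors h).one_le
  have h1 : ∀ p : ℕ, (1 : ℝ) ≤ 1 + 8 / (p : ℝ) := fun p => by
    have : (0 : ℝ) ≤ 8 / (p : ℝ) := by positivity
    linarith
  rw [← Finset.prod_pow]
  calc _ ≤ ∏ p ∈ {2, 3} ∪ n.primeFactors, (1 + 8 / (p : ℝ)) := by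
        refine Finset.prod_le_prod (fun p _ => sq_nonneg _) fun p h => ?_
        have h2 : (1 : ℝ) ≤ p := by exact_mod_cast hp p h
        have h3 : 1 / (p : ℝ) ≤ 1 := by
          rw [div_le_one (by linarith)]; exact h2
        have h4 : 0 ≤ 1 / (p : ℝ) := by positivity
        rw [div_eq_mul_one_div 2, div_eq_mul_one_div 8]
        nlinarith
    _ ≤ (∏ p ∈ ({2, 3} : Finset ℕ), (1 + 8 / (p : ℝ))) * ∏ p ∈ n.primeFactors, (1 + 8 / (p : ℝ)) := by
        rw [← Finset.prod_union_inter]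
        refine le_mul_of_one_le_right (Finset.prod_nonneg fun p _ => by linarith [h1 p]) ?_
        have := Finset.prod_le_prod (s := ({2, 3} : Finset ℕ) ∩ n.primeFactors)
          (f := fun _ : ℕ => (1 : ℝ)) (g := fun p : ℕ => 1 + 8 / (p : ℝ)) (fun _ _ => zero_le_one)
          fun p _ => h1 p
        simpa using this
    _ ≤ _ := by
        refine mul_le_mul_of_nonneg_right ?_ (Finset.prod_nonneg fun p _ => by linarith [h1 p])
        rw [Finset.prod_pair (by norm_num)]
        norm_num

lemma addEnergy_eq (B : Finset ℕ) : _root_.addEnergy B = Finset.addEnergy B B := by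
  rw [Finset.addEnergy_eq_card_filter]
  refine Finset.card_equiv (Equiv.prodAssoc _ _ _).symm ?_
  simp [and_assoc]

open scoped Pointwise in
lemma energy_bound (x y : ℕ) (hy : 0 < y) (B : Finset ℕ)
    (hB : ∀ b ∈ B, b.Prime ∧ b ≤ x) :
    (_root_.addEnergy B : ℝ) ≤ 100 * x * (y : ℝ) ^ 16 +
      76 * kk * mm ^ 2 * x * (x + 1) ^ 2 / Real.log (y + 1) ^ 4 := by
  rw [addEnergy_eq, Finset.addEnergy_eq_sum_sq']
  push_cast
  have hsub : B + B ⊆ Icc 1 (2 * x) := by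
    intro n hn
    obtain ⟨a, ha, b, hb, rfl⟩ := Finset.mem_add.1 hn
    have h1 := hB a ha
    have h2 := hB b hb
    have := h1.1.pos
    rw [mem_Icc]; omega
  refine (Finset.sum_le_sum_of_subset_of_nonneg hsub fun _ _ _ => sq_nonneg _).trans ?_
  have hterm : ∀ n ∈ Icc 1 (2 * x), (((B ×ˢ B).filter (fun q => q.1 + q.2 = n)).card : ℝ) ^ 2 ≤
      50 * (y : ℝ) ^ 16 + (38 * mm ^ 2 * (x + 1) ^ 2 / Real.log (y + 1) ^ 4) *
        ∏ p ∈ n.primeFactors, (1 + 8 / (p : ℝ)) := by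
    intro n hn
    rw [mem_Icc] at hn
    have h1 := pow_le_pow_left₀ (by positivity) (rep_bound n x y hn.1 hy B hB) 2
    refine h1.trans ((add_sq_le (R := ℝ)).trans ?_)
    have h2 := G_sq_le n
    set G := ∏ p ∈ {2, 3} ∪ n.primeFactors, (1 + 2 / (p : ℝ))
    set H := ∏ p ∈ n.primeFactors, (1 + 8 / (p : ℝ))
    have h3 : ((x + 1) * (G * mm / Real.log (y + 1) ^ 2)) ^ 2 =
      (mm ^ 2 * (x + 1) ^ 2 / Real.log (y + 1) ^ 4) * G ^ 2 := by ring
    have h4 := mul_le_mul_of_nonneg_left h2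
      (show 0 ≤ mm ^ 2 * ((x : ℝ) + 1) ^ 2 / Real.log (y + 1) ^ 4 by positivity)
    rw [h3]
    calc _ ≤ 2 * ((mm ^ 2 * (x + 1) ^ 2 / Real.log (y + 1) ^ 4) * (19 * H) +
          (5 * (y : ℝ) ^ 8) ^ 2) := by gcongr
      _ = _ := by ring
  refine (Finset.sum_le_sum fun n hn => le_trans (le_of_eq ?_) (hterm n hn)).trans ?_
  · congr!
  rw [Finset.sum_add_distrib, ← Finset.mul_sum _ _ (_ / _), Finset.sum_const, Nat.card_Icc, nsmul_eq_mul,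
    Nat.add_sub_cancel]
  have hH := mul_le_mul_of_nonneg_left (sum_H_le (2 * x))
    (show 0 ≤ 38 * mm ^ 2 * ((x : ℝ) + 1) ^ 2 / Real.log (y + 1) ^ 4 by positivity)
  refine (add_le_add_right hH _).trans (le_of_eq ?_)
  push_cast
  ring

lemma log_pow_four_le (x : ℝ) (hx : 0 < x) (h1 : 1 ≤ x) : Real.log x ^ 4 ≤ 256 * x := by
  have h := Real.log_le_rpow_div hx.le (show (0 : ℝ) < 1 / 4 by norm_num)
  have h2 := pow_le_pow_left₀ (Real.log_nonneg h1) h 4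
  refine h2.trans (le_of_eq ?_)
  rw [div_pow, ← Real.rpow_natCast, ← Real.rpow_mul hx.le]
  norm_num
  ring

lemma energy_bound' : ∃ C : ℝ, 0 < C ∧ ∀ (x : ℕ) (B : Finset ℕ), 2 ≤ x →
    (∀ b ∈ B, b.Prime ∧ b ≤ x) →
    (_root_.addEnergy B : ℝ) ≤ C * x ^ 3 / Real.log x ^ 4 := by
  refine ⟨25600 + 304 * kk * mm ^ 2 * 16 ^ 4, ?_, ?_⟩
  · have := kk_pos
    positivity
  intro x B hx hB
  have hxR : (2 : ℝ) ≤ x := by exact_mod_cast hx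
  set y := ⌊(x : ℝ) ^ (1 / 16 : ℝ)⌋₊ with hydef
  have hr1 : 1 ≤ (x : ℝ) ^ (1 / 16 : ℝ) := Real.one_le_rpow (by linarith) (by norm_num)
  have hr16 : ((x : ℝ) ^ (1 / 16 : ℝ)) ^ 16 = x := by
    rw [← Real.rpow_natCast, ← Real.rpow_mul (by linarith)]
    norm_num
  have hy : 0 < y := Nat.floor_pos.2 hr1
  have hyle : (y : ℝ) ^ 16 ≤ x := by
    rw [← hr16]
    exact pow_le_pow_left₀ (by positivity) (Nat.floor_le (by linarith)) 16
  have hlogx : 0 < Real.log x := Real.log_pos (by linarith)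
  have hlog : Real.log x / 16 ≤ Real.log (y + 1) := by
    have h1 : (x : ℝ) ^ (1 / 16 : ℝ) ≤ y + 1 := (Nat.lt_floor_add_one _).le
    have h2 := Real.log_le_log (by linarith) h1
    rw [Real.log_rpow (by linarith)] at h2
    linarith
  have hE := energy_bound x y hy B hB
  have hk := kk_pos
  have h4 : Real.log x ^ 4 / 16 ^ 4 ≤ Real.log (y + 1) ^ 4 := by
    rw [← div_pow]
    exact pow_le_pow_left₀ (by positivity) hlog 4
  have h5 : 76 * kk * mm ^ 2 * x * (x + 1) ^ 2 / Real.log (y + 1) ^ 4 ≤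
      76 * kk * mm ^ 2 * x * (2 * x) ^ 2 / (Real.log x ^ 4 / 16 ^ 4) := by
    gcongr
    linarith
  have h6 : 100 * x * (y : ℝ) ^ 16 ≤ 25600 * x ^ 3 / Real.log x ^ 4 := by
    rw [le_div_iff₀ (by positivity)]
    calc 100 * (x : ℝ) * (y : ℝ) ^ 16 * Real.log x ^ 4 ≤ 100 * x * x * (256 * x) := by
          gcongr
          exact log_pow_four_le x (by linarith) (by linarith)
      _ = _ := by ring
  refine hE.trans ((add_le_add h6 h5).trans (le_of_eq ?_))
  field_simp
  ring

lemma nth_prime_le (N : ℕ) (hN : 2 ≤ N) :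
    ((Nat.nth Nat.Prime (N - 1) : ℕ) : ℝ) ≤ 32 * N * Real.log N := by
  set x := Nat.nth Nat.Prime (N - 1) with hx
  have hprime : x.Prime := Nat.prime_nth_prime _
  have hNx : N ≤ x := by
    have := Nat.add_two_le_nth_prime (N - 1)
    omega
  have hpi : Nat.primeCounting x = N := by
    have h1 : Nat.primeCounting' x = N - 1 := Nat.primeCounting'_nth_eq _
    have h2 : Nat.primeCounting x = Nat.primeCounting' x + 1 := by
      unfold Nat.primeCounting Nat.primeCounting'
      rw [Nat.count_succ, if_pos hprime]
    omega
  have h1 := (Chebyshev.psi_ge x).trans (Chebyshev.psi_le_primeCounting_mul_log x)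
  rw [hpi] at h1
  have hNR : (2 : ℝ) ≤ N := by exact_mod_cast hN
  have hxR : (2 : ℝ) ≤ x := by exact_mod_cast hN.trans hNx
  have hlog2 := Real.log_two_gt_d9
  have hlx : 0 < Real.log x := Real.log_pos (by linarith)
  have h2 : Real.log (x + 1) ≤ N * Real.log x := by
    have : Real.log (x + 1) ≤ Real.log ((x : ℝ) ^ 2) :=
      Real.log_le_log (by linarith) (by nlinarith)
    rw [Real.log_pow] at this
    push_cast at this
    nlinarith
  have h3 : (x : ℝ) / 2 ≤ 2 * N * Real.log x := by nlinarith
  -- log x ≤ 2 √x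
  have h4 : Real.log x ≤ 2 * √x := by
    have := Real.log_le_rpow_div (show (0 : ℝ) ≤ x by linarith) (show (0 : ℝ) < 1 / 2 by norm_num)
    rw [← Real.sqrt_eq_rpow] at this
    linarith
  have hs : 0 < √(x : ℝ) := Real.sqrt_pos.2 (by linarith)
  have hss : √(x : ℝ) * √x = x := Real.mul_self_sqrt (by linarith)
  have h5 : √(x : ℝ) ≤ 8 * N := by
    have h6 : √(x : ℝ) * √x ≤ (8 * N) * √x := by
      rw [hss]
      nlinarith
    exact le_of_mul_le_mul_right h6 hs
  have hlN : Real.log 2 ≤ Real.log N := Real.log_le_log (by norm_num) hNR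
  have h7 : Real.log x ≤ 8 * Real.log N := by
    have h8 : Real.log √(x : ℝ) ≤ Real.log (8 * N) := Real.log_le_log hs h5
    rw [Real.log_sqrt (by linarith), Real.log_mul (by norm_num) (by linarith),
      show (8 : ℝ) = 2 ^ 3 by norm_num, Real.log_pow] at h8
    push_cast at h8
    linarith
  nlinarith

open scoped Pointwise in
lemma energy_lower (x : ℕ) (hx : 1 ≤ x) (B : Finset ℕ) (hB : ∀ b ∈ B, b ≤ x) :
    (B.card : ℝ) ^ 4 ≤ 3 * x * _root_.addEnergy B := by
  have h := Finset.le_card_add_mul_addEnergy B B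
  have hc : (B + B).card ≤ 3 * x := by
    have : B + B ⊆ range (2 * x + 1) := by
      intro n hn
      obtain ⟨a, ha, b, hb, rfl⟩ := Finset.mem_add.1 hn
      have h1 := hB a ha
      have h2 := hB b hb
      rw [mem_range]; omega
    have := Finset.card_le_card this
    rw [card_range] at this
    omega
  rw [addEnergy_eq]
  have h2 : B.card ^ 4 ≤ 3 * x * Finset.addEnergy B B := by
    calc B.card ^ 4 = B.card ^ 2 * B.card ^ 2 := by ring
      _ ≤ (B + B).card * Finset.addEnergy B B := by convert! h
      _ ≤ _ := Nat.mul_le_mul_right _ hc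
  exact_mod_cast h2

/-- The additive energy of the set `P_N` of the first `N` primes satisfies
`E(P_N) ≍ N³ / log N`. -/
theorem additiveEnergy_primes_asymp :
    ∃ c₁ c₂ : ℝ, 0 < c₁ ∧ 0 < c₂ ∧ ∀ N : ℕ, 2 ≤ N →
      c₁ * (N : ℝ) ^ 3 / Real.log N ≤ (addEnergy ((Finset.range N).image (Nat.nth Nat.Prime)) : ℝ) ∧
      (addEnergy ((Finset.range N).image (Nat.nth Nat.Prime)) : ℝ) ≤ c₂ * (N : ℝ) ^ 3 / Real.log N := by
  obtain ⟨C, hC, hup⟩ := energy_bound'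
  refine ⟨1 / 96, C * 32 ^ 3, by norm_num, by positivity, ?_⟩
  intro N hN
  have hxle := nth_prime_le N hN
  set x := Nat.nth Nat.Prime (N - 1) with hx
  set B := (Finset.range N).image (Nat.nth Nat.Prime) with hBdef
  have hNx : N ≤ x := by
    have := Nat.add_two_le_nth_prime (N - 1)
    omega
  have hNR : (2 : ℝ) ≤ N := by exact_mod_cast hN
  have hNxR : (N : ℝ) ≤ x := by exact_mod_cast hNx
  have hlN : 0 < Real.log N := Real.log_pos (by linarith)
  have hll : Real.log N ≤ Real.log x := Real.log_le_log (by linarith) hNxR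
  have hB : ∀ b ∈ B, b.Prime ∧ b ≤ x := by
    intro b hb
    obtain ⟨i, hi, rfl⟩ := Finset.mem_image.1 hb
    refine ⟨Nat.prime_nth_prime i, (Nat.nth_monotone Nat.infinite_setOfPred_prime) ?_⟩
    rw [mem_range] at hi
    omega
  have hcard : B.card = N := by
    rw [hBdef, Finset.card_image_of_injective _ (Nat.nth_injective Nat.infinite_setOfPred_prime),
      card_range]
  constructor
  · have h := energy_lower x (by omega) B fun b hb => (hB b hb).2
    rw [hcard] at h
    rw [div_le_iff₀ hlN]
    have hE : (0 : ℝ) ≤ _root_.addEnergy B := by positivity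
    have h2 : (N : ℝ) * N ^ 3 ≤ N * (96 * (_root_.addEnergy B * Real.log N)) := by
      calc (N : ℝ) * N ^ 3 = (N : ℝ) ^ 4 := by ring
        _ ≤ 3 * (x : ℝ) * (_root_.addEnergy B : ℝ) := h
        _ ≤ 3 * (32 * (N : ℝ) * Real.log N) * (_root_.addEnergy B : ℝ) := by gcongr
        _ = _ := by ring
    have h3 := le_of_mul_le_mul_left h2 (by linarith)
    linarith
  · refine (hup x B (by omega) hB).trans ?_
    calc C * (x : ℝ) ^ 3 / Real.log x ^ 4 ≤ C * (32 * N * Real.log N) ^ 3 / Real.log N ^ 4 := by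
          gcongr
      _ = _ := by
          field_simp
end
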